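/- arXiv:2110.11151 — 13 statements merged into one kernel-verified Lean document; each statement's English description precedes it below -/
import Mathlib

section
/- For every pair of scalars (τ, θ) ∈ [0,1]² satisfying τ ≤ θ² and every pair of vectors a, b in a real inner product space ℝⁿ, one has ‖a − (1−θ)b‖² − τ‖a‖² ≥ (1/2)[(1−τ) − (1−θ)²] (‖a‖² − ‖b‖²). -/
/-- For every pair of scalars `(τ, θ) ∈ [0,1]²` satisfying `τ ≤ θ²` and every
pair of vectors `a, b` in `ℝⁿ`, one has
`‖a − (1−θ)b‖² − τ‖a‖² ≥ (1/2)[(1−τ) − (1−θ)²] (‖a‖² − ‖b‖²)`. -/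
theorem stmt_0 {n : ℕ} (τ θ : ℝ) (hτ : τ ∈ Set.Icc (0 : ℝ) 1) (hθ : θ ∈ Set.Icc (0 : ℝ) 1)
    (hτθ : τ ≤ θ ^ 2) (a b : EuclideanSpace ℝ (Fin n)) :
    ‖a - (1 - θ) • b‖ ^ 2 - τ * ‖a‖ ^ 2 ≥
      1 / 2 * ((1 - τ) - (1 - θ) ^ 2) * (‖a‖ ^ 2 - ‖b‖ ^ 2) := by
  have hs : 0 ≤ (1 - θ) * ‖a - b‖ ^ 2 := mul_nonneg (by linarith [hθ.2]) (sq_nonneg _)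
  have ht : 0 ≤ (θ ^ 2 - τ) * (‖a‖ ^ 2 + ‖b‖ ^ 2) := mul_nonneg (by linarith) (by positivity)
  rw [norm_sub_sq_real] at hs ⊢
  rw [real_inner_smul_right, norm_smul, mul_pow, Real.norm_eq_abs, sq_abs]
  linarith
end

section
/- Let ψ : ℝⁿ → (−∞, ∞] be a proper, lower semicontinuous, convex function that is K_ψ-Lipschitz continuous on dom ψ, and suppose dom ψ has finite diameter D_ψ. Then for every y, ȳ ∈ dom ψ and every ξ ∈ ∂ψ(y), one has ‖ξ‖ · dist_{∂(dom ψ)}(ȳ) ≤ [dist_{∂(dom ψ)}(ȳ) + ‖y − ȳ‖] K_ψ + ⟨ξ, y − ȳ⟩, where ∂(dom ψ) denotes the topological boundary of the closure of dom ψ and dist_X(x) denotes the distance from x to the set X. -/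
open RealInnerProductSpace
open scoped Classical

/-- A ball disjoint from the frontier of a set containing its center lies in that set. -/
lemma ball_infDist_frontier_subset {E : Type*} [NormedAddCommGroup E] [NormedSpace ℝ E]
    [FiniteDimensional ℝ E] {s : Set E} {x : E} (hx : x ∈ s) : Metric.ball x (Metric.infDist x (frontier s)) ⊆ s := by
  intro z hz
  by_contra hzs
  obtain ⟨w, hw, hxw⟩ := exists_mem_frontier_infDist_compl_eq_dist hx
    ((Set.ne_univ_iff_exists_notMem s).2 ⟨z, hzs⟩)
  refine ((Metric.infDist_le_dist_of_mem hw).trans ?_).not_gt (Metric.mem_ball'.1 hz)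
  exact hxw ▸ Metric.infDist_le_dist_of_mem hzs

/-- Let `ψ : ℝⁿ → (−∞, ∞]` be a proper, lower semicontinuous, convex function
that is `K`-Lipschitz continuous on its effective domain `D = dom ψ`, and suppose `D` has finite
diameter.  Then for every `y, ȳ ∈ D` and every `ξ ∈ ∂ψ(y)`, one has
`‖ξ‖ · dist_{∂(cl D)}(ȳ) ≤ [dist_{∂(cl D)}(ȳ) + ‖y − ȳ‖] K + ⟪ξ, y − ȳ⟫`,
where `∂(cl D)` is the topological boundary (frontier) of the closure of `D`. -/
theorem stmt_3 {n : ℕ} (ψ : EuclideanSpace ℝ (Fin n) → ℝ) (D : Set (EuclideanSpace ℝ (Fin n)))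
    (hDne : D.Nonempty) (hψconv : ConvexOn ℝ D ψ)
    (hψlsc : LowerSemicontinuous fun x => if x ∈ D then ((ψ x : ℝ) : EReal) else (⊤ : EReal))
    (hDbdd : Bornology.IsBounded D)
    (K : ℝ) (hK : 0 ≤ K) (hψlip : ∀ x ∈ D, ∀ y ∈ D, |ψ x - ψ y| ≤ K * ‖x - y‖)
    (y ybar : EuclideanSpace ℝ (Fin n)) (hy : y ∈ D) (hybar : ybar ∈ D)
    (ξ : EuclideanSpace ℝ (Fin n)) (hξ : ∀ z' ∈ D, ψ z' ≥ ψ y + ⟪ξ, z' - y⟫) :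
    ‖ξ‖ * Metric.infDist ybar (frontier (closure D)) ≤
      (Metric.infDist ybar (frontier (closure D)) + ‖y - ybar‖) * K + ⟪ξ, y - ybar⟫ := by
  have hcl : closure D ⊆ {z | ⟪ξ, z - y⟫ ≤ K * ‖z - y‖} := by
    refine closure_minimal (fun z hz => ?_) (isClosed_le (by fun_prop) (by fun_prop))
    have h₁ := hξ z hz
    have h₂ := (le_abs_self _).trans (hψlip z hz y hy)
    simp only [Set.mem_ofPred_eq]
    linarith
  set d := Metric.infDist ybar (frontier (closure D)) with hd
  have hd_nonneg : 0 ≤ d := Metric.infDist_nonneg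
  obtain ⟨u, hu, hξu⟩ : ∃ u : EuclideanSpace ℝ (Fin n), ‖u‖ ≤ 1 ∧ ⟪ξ, u⟫ = ‖ξ‖ := by
    refine ⟨‖ξ‖⁻¹ • ξ, ?_, ?_⟩
    · rw [norm_smul, norm_inv, norm_norm]
      exact inv_mul_le_one
    · rw [real_inner_smul_right, real_inner_self_eq_norm_mul_norm, ← mul_assoc,
        inv_mul_mul_self]
  have hdu : ‖d • u‖ ≤ d := by
    rw [norm_smul, Real.norm_of_nonneg hd_nonneg]
    exact mul_le_of_le_one_right hd_nonneg hu
  have hz : ybar + d • u ∈ closure D := by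
    rcases hd_nonneg.eq_or_lt with h0 | hpos
    · rw [← h0, zero_smul, add_zero]
      exact subset_closure hybar
    · refine closure_minimal (ball_infDist_frontier_subset (subset_closure hybar))
        isClosed_closure ?_
      rw [← hd, closure_ball ybar hpos.ne']
      simpa [Metric.mem_closedBall, dist_eq_norm] using hdu
  have key : ⟪ξ, ybar + d • u - y⟫ ≤ K * ‖ybar + d • u - y‖ := hcl hz
  have hnorm : ‖ybar + d • u - y‖ ≤ d + ‖y - ybar‖ := by
    rw [show ybar + d • u - y = d • u - (y - ybar) by abel]
    exact (norm_sub_le _ _).trans (by gcongr)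
  have hinner : ⟪ξ, ybar + d • u - y⟫ = d * ‖ξ‖ - ⟪ξ, y - ybar⟫ := by
    rw [show ybar + d • u - y = d • u - (y - ybar) by abel, inner_sub_right,
      real_inner_smul_right, hξu]
  linarith [mul_le_mul_of_nonneg_left hnorm hK]
end

section
/- Let g : ℝⁿ → (−∞, ∞] be a proper convex function and let f be differentiable on dom g. Then for every x ∈ dom g, the infimum over all directions d with ‖d‖ ≤ 1 of the directional derivative (f+g)'(x; d) equals minus the infimum of ‖u‖ over all u ∈ ∇f(x) + ∂g(x), i.e. inf_{‖d‖≤1} (f+g)'(x;d) = − inf{‖u‖ : u ∈ ∇f(x) + ∂g(x)} (with the convention that the infimum over an empty set is +∞). -/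
open RealInnerProductSpace
open scoped Classical

section

variable {E : Type*} [NormedAddCommGroup E] [InnerProductSpace ℝ E]

/-- Points of a ray that are close to the base point lie in a convex set as soon as one of
them does. -/
theorem Convex.eventually_add_smul_mem {D : Set E} (hD : Convex ℝ D) {x d : E} (hx : x ∈ D)
    {τ : ℝ} (hτ : 0 < τ) (hd : x + τ • d ∈ D) :
    ∀ᶠ t : ℝ in nhdsWithin 0 (Set.Ioi 0), x + t • d ∈ D := by
  filter_upwards [Ioo_mem_nhdsGT hτ] with t ht
  have h := hD.add_smul_mem hx hd (t := t / τ)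
    ⟨by have := ht.1; positivity, (div_le_one hτ).2 ht.2.le⟩
  rwa [smul_smul, div_mul_cancel₀ _ hτ.ne'] at h

/-- A within-gradient gives the one-sided directional derivative along rays in the set. -/
theorem HasGradientWithinAt.tendsto_slope_ray [CompleteSpace E] {f : E → ℝ} {v x d : E}
    {D : Set E} (hf : HasGradientWithinAt f v D x)
    (hd : ∀ᶠ t : ℝ in nhdsWithin 0 (Set.Ioi 0), x + t • d ∈ D) :
    Filter.Tendsto (fun t : ℝ => t⁻¹ * (f (x + t • d) - f x))
      (nhdsWithin 0 (Set.Ioi 0)) (nhds ⟪v, d⟫) := by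
  have hlim : Filter.Tendsto (fun t : ℝ => t • d) (nhdsWithin 0 (Set.Ioi 0)) (nhds 0) := by
    have : Continuous fun t : ℝ => t • d := by fun_prop
    simpa using (this.tendsto 0).mono_left nhdsWithin_le_nhds
  have h := hf.hasFDerivWithinAt.lim (c := fun t : ℝ => t⁻¹) hlim hd
    (tendsto_const_nhds.congr' (f₁ := fun _ => d) (by
      filter_upwards [self_mem_nhdsWithin] with t ht
      rw [smul_smul, inv_mul_cancel₀ (ne_of_gt ht), one_smul]))
  simpa using h

/-- A convex function bounded below by `-m ‖· - x‖` and vanishing at `x` has an affine minorant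
vanishing at `x` with slope of norm at most `m`. -/
theorem ConvexOn.exists_inner_le_of_neg_mul_norm_le [CompleteSpace E] {D : Set E} {G : E → ℝ}
    (hG : ConvexOn ℝ D G) {x : E} (hx : x ∈ D) (hGx : G x = 0) {m : ℝ} (hm : 0 ≤ m)
    (hle : ∀ z ∈ D, -(m * ‖z - x‖) ≤ G z) :
    ∃ u : E, ‖u‖ ≤ m ∧ ∀ z ∈ D, ⟪u, z - x⟫ ≤ G z := by
  have hA : Convex ℝ {p : E × ℝ | p.1 ∈ Set.univ ∧ p.2 < -(m * ‖p.1 - x‖)} := by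
    refine ConcaveOn.convex_strict_hypograph (f := fun z : E => -(m * ‖z - x‖))
      (ConvexOn.neg (f := fun z => m * ‖z - x‖) ⟨convex_univ, fun a _ b _ p q hp hq hpq => ?_⟩)
    have e : p • a + q • b - x = p • (a - x) + q • (b - x) := by
      have : x = p • x + q • x := by rw [← add_smul, hpq, one_smul]
      nth_rewrite 1 [this]
      simp only [smul_sub]; abel
    have h2 := norm_add_le (p • (a - x)) (q • (b - x))
    rw [norm_smul_of_nonneg hp, norm_smul_of_nonneg hq] at h2
    simp only [e, smul_eq_mul]
    nlinarith [mul_le_mul_of_nonneg_left h2 hm]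
  have hAo : IsOpen {p : E × ℝ | p.1 ∈ Set.univ ∧ p.2 < -(m * ‖p.1 - x‖)} := by
    simp only [Set.mem_univ, true_and]
    exact isOpen_lt (by fun_prop) (by fun_prop)
  obtain ⟨F, c, hFA, hFB⟩ := geometric_hahn_banach_open hA hAo hG.convex_epigraph (by
    refine Set.disjoint_left.2 fun p hp hq => ?_
    have := hle p.1 hq.1
    linarith [hp.2, hq.2])
  let L : E →L[ℝ] ℝ := F.comp (ContinuousLinearMap.inl ℝ E ℝ)
  have hF (d : E) (a : ℝ) : F (d, a) = L d + a * F (0, 1) := by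
    have : ((d, a) : E × ℝ) = (d, 0) + a • (0, 1) := by
      ext <;> simp
    rw [this, map_add, map_smul, smul_eq_mul]; rfl
  have hc : c ≤ L x := hFB (x, 0) ⟨hx, hGx.le⟩
  set β := F (0, 1)
  have hA' (d : E) (ε : ℝ) (hε : 0 < ε) : L d + (-(m * ‖d - x‖) - ε) * β < c := by
    rw [← hF]; exact hFA _ ⟨trivial, by simp [hε]⟩
  have hβ : 0 < β := by have := hA' x 1 one_pos; simp only [sub_self, norm_zero] at this; linarith
  have hA0 (d : E) : L d - m * ‖d - x‖ * β ≤ c := by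
    refine le_of_forall_pos_le_add fun ε hε => ?_
    have := hA' d (ε / β) (by positivity)
    have e : ε / β * β = ε := div_mul_cancel₀ _ hβ.ne'
    linarith
  have hc' : L x = c := le_antisymm (by simpa using hA0 x) hc
  let v := (InnerProductSpace.toDual ℝ E).symm L
  have hv (d : E) : ⟪v, d⟫ = L d := InnerProductSpace.toDual_symm_apply
  refine ⟨-(β⁻¹ • v), ?_, fun z hz => ?_⟩
  · have h := hA0 (x + v)
    rw [map_add, ← hv v, add_sub_cancel_left, real_inner_self_eq_norm_sq] at h
    rw [norm_neg, norm_smul_of_nonneg (by positivity), inv_mul_le_iff₀ hβ]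
    rcases (norm_nonneg v).eq_or_lt with h0 | h0
    · rw [← h0]; positivity
    · nlinarith
  · have h : c ≤ F (z, G z) := hFB (z, G z) ⟨hz, le_rfl⟩
    rw [hF] at h
    rw [inner_neg_left, real_inner_smul_left, hv, map_sub, neg_le, le_inv_mul_iff₀ hβ]
    linarith

end

/-- Let `g : ℝⁿ → (−∞, ∞]` be a proper convex function (encoded by a real-valued
function `g` on its effective domain `D`) and let `f` be differentiable on `D` (with gradient
`f'`).  For `x ∈ D`, let `φ d ∈ [−∞, ∞]` denote the directional derivative `(f+g)'(x; d)`, i.e.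
the limit as `t ↓ 0` of `[(f+g)(x+td) − (f+g)(x)]/t`, where `f + g` takes the value `+∞` off `D`.
Then `inf_{‖d‖ ≤ 1} (f+g)'(x; d) = − inf {‖u‖ : u ∈ ∇f(x) + ∂g(x)}`, the infima being taken in
the extended reals (so the infimum of the empty set is `+∞`). -/
theorem stmt_4 {n : ℕ} (g : EuclideanSpace ℝ (Fin n) → ℝ) (D : Set (EuclideanSpace ℝ (Fin n)))
    (hDne : D.Nonempty) (hgconv : ConvexOn ℝ D g)
    (f : EuclideanSpace ℝ (Fin n) → ℝ) (f' : EuclideanSpace ℝ (Fin n) → EuclideanSpace ℝ (Fin n))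
    (hf : ∀ y ∈ D, HasGradientWithinAt f (f' y) D y)
    (x : EuclideanSpace ℝ (Fin n)) (hx : x ∈ D)
    (φ : EuclideanSpace ℝ (Fin n) → EReal)
    (hφ : ∀ d : EuclideanSpace ℝ (Fin n),
      Filter.Tendsto
        (fun t : ℝ => ((t⁻¹ : ℝ) : EReal) *
          ((if x + t • d ∈ D then ((f (x + t • d) + g (x + t • d) : ℝ) : EReal) else ⊤) -
            ((f x + g x : ℝ) : EReal)))
        (nhdsWithin 0 (Set.Ioi 0)) (nhds (φ d))) :
    (⨅ d ∈ {d : EuclideanSpace ℝ (Fin n) | ‖d‖ ≤ 1}, φ d) =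
      - ⨅ u ∈ {u : EuclideanSpace ℝ (Fin n) |
          ∃ s, (∀ z' ∈ D, g z' ≥ g x + ⟪s, z' - x⟫) ∧ u = f' x + s}, (‖u‖ : EReal) := by
  have hquot {d : EuclideanSpace ℝ (Fin n)} {t : ℝ} (h : x + t • d ∈ D) :
      ((t⁻¹ : ℝ) : EReal) *
          ((if x + t • d ∈ D then ((f (x + t • d) + g (x + t • d) : ℝ) : EReal) else ⊤) -
            ((f x + g x : ℝ) : EReal)) =
        ((t⁻¹ * (f (x + t • d) - f x) + t⁻¹ * (g (x + t • d) - g x) : ℝ) : EReal) := by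
    rw [if_pos h, ← EReal.coe_sub, ← EReal.coe_mul]
    congr 1; ring
  have hupper (z) (hz : z ∈ D) (r : ℝ) (hr : 0 < r) :
      φ (r • (z - x)) ≤ ((⟪f' x, r • (z - x)⟫ + r * (g z - g x) : ℝ) : EReal) := by
    have hev := hgconv.1.eventually_add_smul_mem hx (d := r • (z - x)) (inv_pos.2 hr)
      (by rwa [smul_smul, inv_mul_cancel₀ hr.ne', one_smul, add_sub_cancel])
    refine le_of_tendsto_of_tendsto (hφ _) ((continuous_coe_real_ereal.tendsto _).comp
      (((hf x hx).tendsto_slope_ray hev).add_const (r * (g z - g x)))) ?_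
    filter_upwards [hev, Ioo_mem_nhdsGT (inv_pos.2 hr)] with t ht ht'
    rw [hquot ht]
    simp only [Function.comp_apply, EReal.coe_le_coe_iff, add_le_add_iff_left]
    have ht0 : 0 < t := ht'.1
    have htr : t * r ≤ 1 := by
      have := mul_le_mul_of_nonneg_right ht'.2.le hr.le
      rwa [inv_mul_cancel₀ hr.ne'] at this
    have hcv := hgconv.2 hx hz (sub_nonneg.2 htr) (by positivity : 0 ≤ t * r) (by ring)
    have e : (1 - t * r) • x + (t * r) • z = x + t • r • (z - x) := by
      simp only [sub_smul, smul_sub, mul_smul, one_smul]; abel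
    rw [e] at hcv
    simp only [smul_eq_mul] at hcv
    rw [inv_mul_le_iff₀ ht0]
    linarith
  have hlower (s) (hs : ∀ z' ∈ D, g z' ≥ g x + ⟪s, z' - x⟫) (d) :
      ((⟪f' x + s, d⟫ : ℝ) : EReal) ≤ φ d := by
    by_cases hd : ∃ τ : ℝ, 0 < τ ∧ x + τ • d ∈ D
    · obtain ⟨τ, hτ, hd⟩ := hd
      have hev := hgconv.1.eventually_add_smul_mem hx hτ hd
      rw [inner_add_left]
      refine le_of_tendsto_of_tendsto ((continuous_coe_real_ereal.tendsto _).comp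
        (((hf x hx).tendsto_slope_ray hev).add_const ⟪s, d⟫)) (hφ d) ?_
      filter_upwards [hev, self_mem_nhdsWithin] with t ht ht0
      rw [hquot ht]
      simp only [Function.comp_apply, EReal.coe_le_coe_iff, add_le_add_iff_left]
      have := hs _ ht
      rw [add_sub_cancel_left, real_inner_smul_right] at this
      rw [le_inv_mul_iff₀ ht0]
      linarith
    · push Not at hd
      refine le_of_tendsto_of_tendsto tendsto_const_nhds (hφ d) ?_
      filter_upwards [self_mem_nhdsWithin] with t ht
      rw [if_neg (hd t ht), EReal.top_sub_coe, EReal.coe_mul_top_of_pos (inv_pos.2 ht)]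
      exact le_top
  apply le_antisymm
  · rw [EReal.le_neg]
    set L := ⨅ d ∈ {d : EuclideanSpace ℝ (Fin n) | ‖d‖ ≤ 1}, φ d
    have hLle (d : EuclideanSpace ℝ (Fin n)) (hd : ‖d‖ ≤ 1) : L ≤ φ d := iInf₂_le d hd
    have hL0 : L ≤ 0 := by
      refine (hLle 0 (by simp)).trans ?_
      simpa using hupper x hx 1 one_pos
    clear_value L
    induction L with
    | bot => simp
    | top => simp at hL0
    | coe l =>
      have hl : l ≤ 0 := by exact_mod_cast hL0
      have hG : ConvexOn ℝ D (fun z => g z + (⟪f' x, z⟫ - (g x + ⟪f' x, x⟫))) :=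
        hgconv.add (((innerSL ℝ (f' x)).toLinearMap.convexOn hgconv.1).add_const
          (-(g x + ⟪f' x, x⟫)))
      obtain ⟨u, hum, hu⟩ := hG.exists_inner_le_of_neg_mul_norm_le hx (by ring)
        (neg_nonneg.2 hl) (fun z hz => by
          rcases eq_or_ne z x with rfl | hne
          · simp
          have hpos : 0 < ‖z - x‖ := norm_pos_iff.2 (sub_ne_zero.2 hne)
          have h := (hLle (‖z - x‖⁻¹ • (z - x)) (by
            rw [norm_smul_of_nonneg (by positivity), inv_mul_cancel₀ hpos.ne'])).trans
            (hupper z hz _ (inv_pos.2 hpos))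
          rw [EReal.coe_le_coe_iff, real_inner_smul_right, ← mul_add, le_inv_mul_iff₀ hpos,
            inner_sub_right] at h
          linarith)
      refine (iInf₂_le u ⟨u - f' x, fun z hz => ?_, by abel⟩).trans (by exact_mod_cast hum)
      have := hu z hz
      rw [inner_sub_left]
      simp only [inner_sub_right] at this ⊢
      linarith
  · refine le_iInf₂ fun d hd => ?_
    rw [EReal.neg_le]
    refine le_iInf₂ fun u hu => ?_
    obtain ⟨s, hs, rfl⟩ := hu
    rw [EReal.neg_le]
    refine le_trans ?_ (hlower s hs d)
    rw [← EReal.coe_neg, EReal.coe_le_coe_iff]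
    have h1 := neg_le_of_abs_le (abs_real_inner_le_norm (f' x + s) d)
    have h2 : ‖f' x + s‖ * ‖d‖ ≤ ‖f' x + s‖ := mul_le_of_le_one_right (norm_nonneg _) hd
    linarith
end

section
/- Let A : ℝⁿ → ℝˡ be linear, b ∈ ℝˡ, c > 0, θ ∈ (0,1), χ > 0, and let f, h be such that the θ-dampened augmented Lagrangian L_c^θ(z;p) := f(z) + h(z) + (1−θ)⟨p, Az−b⟩ + (c/2)‖Az−b‖² is finite at z. Suppose p, p₋ ∈ ℝˡ satisfy p = (1−θ)p₋ + χ c (Az − b). Then L_c^θ(z; p) − L_c^θ(z; p₋) = (b_θ / (2χc)) ‖p − p₋‖² + (a_θ / (2χc)) (‖p‖² − ‖p₋‖²), where a_θ := θ(1−θ) and b_θ := (2−θ)(1−θ). -/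
open RealInnerProductSpace

/-- The θ-dampened augmented Lagrangian
`L_c^θ(z; p) = f(z) + h(z) + (1−θ)⟪p, Az−b⟫ + (c/2)‖Az−b‖²`. -/
noncomputable def augLag {n l : ℕ} (f h : EuclideanSpace ℝ (Fin n) → ℝ)
    (A : EuclideanSpace ℝ (Fin n) →L[ℝ] EuclideanSpace ℝ (Fin l))
    (b : EuclideanSpace ℝ (Fin l)) (c θ : ℝ) (z : EuclideanSpace ℝ (Fin n))
    (p : EuclideanSpace ℝ (Fin l)) : ℝ :=
  f z + h z + (1 - θ) * ⟪p, A z - b⟫ + c / 2 * ‖A z - b‖ ^ 2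

/-- With `c > 0`, `θ ∈ (0,1)`, `χ > 0`, if the multipliers satisfy
`p = (1−θ)p₋ + χc(Az − b)` then
`L_c^θ(z; p) − L_c^θ(z; p₋) = (b_θ/(2χc))‖p − p₋‖² + (a_θ/(2χc))(‖p‖² − ‖p₋‖²)`,
where `a_θ = θ(1−θ)` and `b_θ = (2−θ)(1−θ)`. -/
theorem stmt_7 {n l : ℕ} (f h : EuclideanSpace ℝ (Fin n) → ℝ)
    (A : EuclideanSpace ℝ (Fin n) →L[ℝ] EuclideanSpace ℝ (Fin l))
    (b : EuclideanSpace ℝ (Fin l)) (c θ χ : ℝ)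
    (hc : 0 < c) (hθ : θ ∈ Set.Ioo (0 : ℝ) 1) (hχ : 0 < χ)
    (z : EuclideanSpace ℝ (Fin n)) (p pm : EuclideanSpace ℝ (Fin l))
    (hp : p = (1 - θ) • pm + (χ * c) • (A z - b)) :
    augLag f h A b c θ z p - augLag f h A b c θ z pm =
      ((2 - θ) * (1 - θ)) / (2 * χ * c) * ‖p - pm‖ ^ 2 +
        (θ * (1 - θ)) / (2 * χ * c) * (‖p‖ ^ 2 - ‖pm‖ ^ 2) := by
  have hχc : χ * c ≠ 0 := (mul_pos hχ hc).ne'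
  have h_res : (χ * c) • (A z - b) = (p - pm) + θ • pm := by
    rw [hp]; module
  have h_inner : χ * c * ⟪p - pm, A z - b⟫ = ‖p - pm‖ ^ 2 + θ * ⟪p - pm, pm⟫ := by
    rw [← real_inner_smul_right, h_res, inner_add_right, real_inner_smul_right,
      real_inner_self_eq_norm_sq]
  have h_polar : ‖p‖ ^ 2 = ‖p - pm‖ ^ 2 + 2 * ⟪p - pm, pm⟫ + ‖pm‖ ^ 2 := by
    rw [← norm_add_sq_real, sub_add_cancel]
  have h_diff : augLag f h A b c θ z p - augLag f h A b c θ z pm =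
      (1 - θ) * ⟪p - pm, A z - b⟫ := by
    rw [augLag, augLag, inner_sub_left]; ring
  rw [h_diff, h_polar, eq_div_of_mul_eq hχc ((mul_comm _ _).trans h_inner)]
  field_simp
  ring
end

section
/- Let h : ℝⁿ → (−∞, ∞] be proper, lower semicontinuous and convex, and let f be differentiable on ℝⁿ with −(m/2)‖u−z‖² ≤ f(u) − f(z) − ⟨∇f(z), u−z⟩ for all u, z and some m > 0. Let λ = 1/(2m), σ ∈ (0, 1/2], c > 0, θ ∈ (0,1), p ∈ ℝˡ, and let z₀ ∈ dom h and z₁ ∈ ℝⁿ satisfy v ∈ ∂(λ L_c^θ(·; p) + (1/2)‖· − z₀‖²)(z₁) with ‖v‖ ≤ σ‖z₁ − z₀‖. Then L_c^θ(z₁; p) − L_c^θ(z₀; p) ≤ −(1/(8λ))‖z₁ − z₀‖² − (c/4)‖A(z₁ − z₀)‖². -/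
open RealInnerProductSpace
open scoped Classical

/-- Let `h` be proper lsc convex (encoded by a real-valued `h` on its effective
domain `D`), and let `f` be differentiable on `ℝⁿ` with
`−(m/2)‖u−z‖² ≤ f(u) − f(z) − ⟪∇f(z), u−z⟫` for all `u, z` and some `m > 0`.  Let `λ = 1/(2m)`,
`σ ∈ (0, 1/2]`, `c > 0`, `θ ∈ (0,1)`, `p ∈ ℝˡ`, and suppose `z₀ ∈ dom h` and `z₁` satisfy
`v ∈ ∂(λ L_c^θ(·; p) + (1/2)‖· − z₀‖²)(z₁)` with `‖v‖ ≤ σ‖z₁ − z₀‖`.  Then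
`L_c^θ(z₁; p) − L_c^θ(z₀; p) ≤ −(1/(8λ))‖z₁ − z₀‖² − (c/4)‖A(z₁ − z₀)‖²`. -/
theorem stmt_8 {n l : ℕ} (h : EuclideanSpace ℝ (Fin n) → ℝ)
    (D : Set (EuclideanSpace ℝ (Fin n))) (hDne : D.Nonempty) (hhconv : ConvexOn ℝ D h)
    (hhlsc : LowerSemicontinuous fun x => if x ∈ D then ((h x : ℝ) : EReal) else (⊤ : EReal))
    (f : EuclideanSpace ℝ (Fin n) → ℝ) (f' : EuclideanSpace ℝ (Fin n) → EuclideanSpace ℝ (Fin n))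
    (hf : ∀ x, HasGradientAt f (f' x) x)
    (m : ℝ) (hm : 0 < m)
    (hwc : ∀ u z, -(m / 2) * ‖u - z‖ ^ 2 ≤ f u - f z - ⟪f' z, u - z⟫)
    (lam σ c θ : ℝ) (hlam : lam = 1 / (2 * m)) (hσ : σ ∈ Set.Ioc (0 : ℝ) (1 / 2)) (hc : 0 < c)
    (hθ : θ ∈ Set.Ioo (0 : ℝ) 1)
    (A : EuclideanSpace ℝ (Fin n) →L[ℝ] EuclideanSpace ℝ (Fin l))
    (b p : EuclideanSpace ℝ (Fin l))
    (z₀ : EuclideanSpace ℝ (Fin n)) (hz₀ : z₀ ∈ D)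
    (z₁ : EuclideanSpace ℝ (Fin n)) (hz₁ : z₁ ∈ D) (v : EuclideanSpace ℝ (Fin n))
    (hsub : ∀ z' ∈ D,
      lam * augLag f h A b c θ z' p + 1 / 2 * ‖z' - z₀‖ ^ 2 ≥
        lam * augLag f h A b c θ z₁ p + 1 / 2 * ‖z₁ - z₀‖ ^ 2 + ⟪v, z' - z₁⟫)
    (hv : ‖v‖ ≤ σ * ‖z₁ - z₀‖) :
    augLag f h A b c θ z₁ p - augLag f h A b c θ z₀ p ≤
      -(1 / (8 * lam)) * ‖z₁ - z₀‖ ^ 2 - c / 4 * ‖A (z₁ - z₀)‖ ^ 2 := by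
  obtain ⟨e, rfl⟩ : ∃ e, z₀ = z₁ + (2 : ℝ) • e := ⟨(2 : ℝ)⁻¹ • (z₀ - z₁), by simp⟩
  have hmid : z₁ + e = (1 / 2 : ℝ) • z₁ + (1 / 2 : ℝ) • (z₁ + (2 : ℝ) • e) := by module
  have hD : z₁ + e ∈ D :=
    hmid ▸ hhconv.1 hz₁ hz₀ (by norm_num) (by norm_num) (by norm_num)
  have hh : h (z₁ + e) ≤ 1 / 2 * h z₁ + 1 / 2 * h (z₁ + (2 : ℝ) • e) := by
    have := hhconv.2 hz₁ hz₀ (one_half_pos (α := ℝ)).le (one_half_pos (α := ℝ)).le (by norm_num)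
    rwa [← hmid] at this
  have hf0 := hwc (z₁ + (2 : ℝ) • e) (z₁ + e)
  have hf1 := hwc z₁ (z₁ + e)
  rw [show z₁ + (2 : ℝ) • e - (z₁ + e) = e by module] at hf0
  rw [show z₁ - (z₁ + e) = -e by module, norm_neg, inner_neg_right] at hf1
  have hs := hsub _ hD
  rw [show z₁ + e - (z₁ + (2 : ℝ) • e) = -e by module,
    show z₁ - (z₁ + (2 : ℝ) • e) = -((2 : ℝ) • e) by module, norm_neg, norm_neg,
    norm_smul, Real.norm_ofNat, show z₁ + e - z₁ = e by module] at hs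
  rw [show z₁ - (z₁ + (2 : ℝ) • e) = -((2 : ℝ) • e) by module] at hv ⊢
  rw [norm_neg, norm_smul, Real.norm_ofNat] at hv
  rw [map_neg, norm_neg, norm_neg, map_smul, norm_smul, norm_smul, Real.norm_ofNat]
  have hve : -‖e‖ ^ 2 ≤ ⟪v, e⟫ := by
    have h1 : ‖v‖ ≤ ‖e‖ := by nlinarith [hσ.2, norm_nonneg e]
    nlinarith [neg_le_of_abs_le (abs_real_inner_le_norm v e), norm_nonneg e]
  have hq (t : ℝ) : ‖A (z₁ + t • e) - b‖ ^ 2 =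
      ‖A z₁ - b‖ ^ 2 + 2 * t * ⟪A z₁ - b, A e⟫ + t ^ 2 * ‖A e‖ ^ 2 := by
    rw [show A (z₁ + t • e) - b = (A z₁ - b) + t • A e by rw [map_add, map_smul]; module,
      norm_add_sq_real, inner_smul_right, norm_smul, mul_pow, Real.norm_eq_abs, sq_abs]
    ring
  have hl (t : ℝ) : ⟪p, A (z₁ + t • e) - b⟫ = ⟪p, A z₁ - b⟫ + t * ⟪p, A e⟫ := by
    rw [show A (z₁ + t • e) - b = (A z₁ - b) + t • A e by rw [map_add, map_smul]; module,
      inner_add_right, inner_smul_right]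
  have hq1 := hq 1
  have hl1 := hl 1
  rw [one_smul] at hq1 hl1
  have hL : augLag f h A b c θ (z₁ + e) p ≤
      1 / 2 * augLag f h A b c θ z₁ p + 1 / 2 * augLag f h A b c θ (z₁ + (2 : ℝ) • e) p
        + m / 2 * ‖e‖ ^ 2 - c / 2 * ‖A e‖ ^ 2 := by
    unfold augLag
    rw [hq1, hl1, hq 2, hl 2]
    linarith
  have h8 : 1 / (8 * lam) = m / 4 := by rw [hlam]; field_simp; norm_num
  have hs' : augLag f h A b c θ z₁ p - augLag f h A b c θ (z₁ + e) p ≤ -m * ‖e‖ ^ 2 := by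
    have h2 : 2 * m * lam = 1 := by rw [hlam]; field_simp
    have h3 : lam * (augLag f h A b c θ z₁ p - augLag f h A b c θ (z₁ + e) p) ≤
        -(1 / 2) * ‖e‖ ^ 2 := by nlinarith
    have h4 := mul_le_mul_of_nonneg_left h3 (by positivity : 0 ≤ 2 * m)
    rw [← mul_assoc, h2] at h4
    linarith
  rw [h8]
  nlinarith
end

section
/- Let h : ℝⁿ → (−∞, ∞] be proper, lower semicontinuous and convex, and let f be differentiable on ℝⁿ with −(m/2)‖u−z‖² ≤ f(u) − f(z) − ⟨∇f(z), u−z⟩ for all u, z and some m > 0. Let λ = 1/(2m), σ ∈ (0, 1/2], c > 0, (χ, θ) ∈ (0,1)², p₋ ∈ ℝˡ, z₀ ∈ dom h, and suppose z₁, v satisfy v ∈ ∂(λ L_c^θ(·; p₋) + (1/2)‖· − z₀‖²)(z₁) with ‖v‖ ≤ σ‖z₁ − z₀‖, and p := (1−θ)p₋ + χ c (Az₁ − b). Define v̂ := (v + z₀ − z₁)/λ. Then (λ/32)‖v̂‖² ≤ [L_c^θ(z₀; p₋) − L_c^θ(z₁; p) + (a_θ/(2χc))(‖p‖² − ‖p₋‖²)]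 + (b_θ/(2χc))‖p − p₋‖² − (c/4)‖A(z₁ − z₀)‖², where a_θ := θ(1−θ) and b_θ := (2−θ)(1−θ). -/
open RealInnerProductSpace
open scoped Classical

/-- A function with a quadratic lower bound `-(m/2)‖u - z‖²` on its linearization error satisfies
the midpoint inequality of weak convexity. -/
theorem midpoint_le_of_linearization_ge {E : Type*} [NormedAddCommGroup E] [InnerProductSpace ℝ E]
    {f : E → ℝ} {f' : E → E} {m : ℝ}
    (hwc : ∀ u z, -(m / 2) * ‖u - z‖ ^ 2 ≤ f u - f z - ⟪f' z, u - z⟫) (x y : E) :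
    f ((1 / 2 : ℝ) • x + (1 / 2 : ℝ) • y) ≤ (f x + f y) / 2 + m / 8 * ‖y - x‖ ^ 2 := by
  have hx := hwc x ((1 / 2 : ℝ) • x + (1 / 2 : ℝ) • y)
  have hy := hwc y ((1 / 2 : ℝ) • x + (1 / 2 : ℝ) • y)
  have ex : x - ((1 / 2 : ℝ) • x + (1 / 2 : ℝ) • y) = (-(1 / 2) : ℝ) • (y - x) := by module
  have ey : y - ((1 / 2 : ℝ) • x + (1 / 2 : ℝ) • y) = (1 / 2 : ℝ) • (y - x) := by module
  rw [ex, norm_smul, mul_pow, real_inner_smul_right] at hx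
  rw [ey, norm_smul, mul_pow, real_inner_smul_right] at hy
  norm_num at hx hy
  linarith

/-- The midpoint inequality for the dampened augmented Lagrangian, when the smooth part is weakly
convex and the nonsmooth part is convex. -/
theorem augLag_midpoint_le {n l : ℕ} {f h : EuclideanSpace ℝ (Fin n) → ℝ}
    {f' : EuclideanSpace ℝ (Fin n) → EuclideanSpace ℝ (Fin n)}
    {D : Set (EuclideanSpace ℝ (Fin n))} (hh : ConvexOn ℝ D h) {m : ℝ}
    (hwc : ∀ u z, -(m / 2) * ‖u - z‖ ^ 2 ≤ f u - f z - ⟪f' z, u - z⟫)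
    (A : EuclideanSpace ℝ (Fin n) →L[ℝ] EuclideanSpace ℝ (Fin l))
    (b : EuclideanSpace ℝ (Fin l)) (c θ : ℝ) (q : EuclideanSpace ℝ (Fin l))
    {x y : EuclideanSpace ℝ (Fin n)} (hx : x ∈ D) (hy : y ∈ D) :
    augLag f h A b c θ ((1 / 2 : ℝ) • x + (1 / 2 : ℝ) • y) q ≤
      (augLag f h A b c θ x q + augLag f h A b c θ y q) / 2 + m / 8 * ‖y - x‖ ^ 2
        - c / 8 * ‖A (y - x)‖ ^ 2 := by
  have hfm := midpoint_le_of_linearization_ge hwc x y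
  have hhm := hh.2 hx hy (by norm_num : (0 : ℝ) ≤ 1 / 2) (by norm_num : (0 : ℝ) ≤ 1 / 2)
    (by norm_num)
  have hw : A ((1 / 2 : ℝ) • x + (1 / 2 : ℝ) • y) - b
      = (1 / 2 : ℝ) • ((A x - b) + (A y - b)) := by
    simp only [map_add, map_smul]
    module
  have hd : A (y - x) = (A y - b) - (A x - b) := by
    rw [map_sub]
    abel
  have hadd := norm_add_sq_real (A x - b) (A y - b)
  have hsub := norm_sub_sq_real (A y - b) (A x - b)
  rw [real_inner_comm] at hsub
  simp only [augLag, smul_eq_mul] at hhm ⊢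
  rw [hw, hd, hsub, real_inner_smul_right, inner_add_right, norm_smul, mul_pow, hadd]
  norm_num
  linarith

/-- Updating the multiplier with dampening changes the augmented Lagrangian by a combination of
`‖p‖² - ‖q‖²` and `‖p - q‖²`. -/
theorem augLag_sub_augLag_multiplier_update {n l : ℕ} (f h : EuclideanSpace ℝ (Fin n) → ℝ)
    (A : EuclideanSpace ℝ (Fin n) →L[ℝ] EuclideanSpace ℝ (Fin l))
    (b : EuclideanSpace ℝ (Fin l)) {c χ : ℝ} (θ : ℝ) (hc : c ≠ 0) (hχ : χ ≠ 0)
    (z : EuclideanSpace ℝ (Fin n)) {p q : EuclideanSpace ℝ (Fin l)}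
    (hp : p = (1 - θ) • q + (χ * c) • (A z - b)) :
    augLag f h A b c θ z p - augLag f h A b c θ z q =
      (θ * (1 - θ)) / (2 * χ * c) * (‖p‖ ^ 2 - ‖q‖ ^ 2)
        + ((2 - θ) * (1 - θ)) / (2 * χ * c) * ‖p - q‖ ^ 2 := by
  have hs : A z - b = (χ * c)⁻¹ • (p - (1 - θ) • q) := by
    rw [hp, add_sub_cancel_left, smul_smul, inv_mul_cancel₀ (mul_ne_zero hχ hc), one_smul]
  have hpq := norm_sub_sq_real p q
  simp only [augLag]
  rw [hs, hpq]
  simp only [real_inner_smul_right, inner_sub_right, real_inner_self_eq_norm_sq,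
    real_inner_comm p q]
  field_simp
  ring

/-- In the setting of Statement 8, additionally with `(χ, θ) ∈ (0,1)²` and the
multiplier update `p = (1−θ)p₋ + χc(Az₁ − b)`, the refined residual `v̂ = (v + z₀ − z₁)/λ`
satisfies
`(λ/32)‖v̂‖² ≤ [L_c^θ(z₀; p₋) − L_c^θ(z₁; p) + (a_θ/(2χc))(‖p‖² − ‖p₋‖²)]
              + (b_θ/(2χc))‖p − p₋‖² − (c/4)‖A(z₁ − z₀)‖²`,
where `a_θ = θ(1−θ)` and `b_θ = (2−θ)(1−θ)`. -/
theorem stmt_9 {n l : ℕ} (h : EuclideanSpace ℝ (Fin n) → ℝ)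
    (D : Set (EuclideanSpace ℝ (Fin n))) (hDne : D.Nonempty) (hhconv : ConvexOn ℝ D h)
    (hhlsc : LowerSemicontinuous fun x => if x ∈ D then ((h x : ℝ) : EReal) else (⊤ : EReal))
    (f : EuclideanSpace ℝ (Fin n) → ℝ) (f' : EuclideanSpace ℝ (Fin n) → EuclideanSpace ℝ (Fin n))
    (hf : ∀ x, HasGradientAt f (f' x) x)
    (m : ℝ) (hm : 0 < m)
    (hwc : ∀ u z, -(m / 2) * ‖u - z‖ ^ 2 ≤ f u - f z - ⟪f' z, u - z⟫)
    (lam σ c χ θ : ℝ) (hlam : lam = 1 / (2 * m)) (hσ : σ ∈ Set.Ioc (0 : ℝ) (1 / 2)) (hc : 0 < c)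
    (hχ : χ ∈ Set.Ioo (0 : ℝ) 1) (hθ : θ ∈ Set.Ioo (0 : ℝ) 1)
    (A : EuclideanSpace ℝ (Fin n) →L[ℝ] EuclideanSpace ℝ (Fin l))
    (b pm : EuclideanSpace ℝ (Fin l))
    (z₀ : EuclideanSpace ℝ (Fin n)) (hz₀ : z₀ ∈ D)
    (z₁ : EuclideanSpace ℝ (Fin n)) (hz₁ : z₁ ∈ D) (v : EuclideanSpace ℝ (Fin n))
    (hsub : ∀ z' ∈ D,
      lam * augLag f h A b c θ z' pm + 1 / 2 * ‖z' - z₀‖ ^ 2 ≥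
        lam * augLag f h A b c θ z₁ pm + 1 / 2 * ‖z₁ - z₀‖ ^ 2 + ⟪v, z' - z₁⟫)
    (hv : ‖v‖ ≤ σ * ‖z₁ - z₀‖)
    (p : EuclideanSpace ℝ (Fin l)) (hp : p = (1 - θ) • pm + (χ * c) • (A z₁ - b))
    (vhat : EuclideanSpace ℝ (Fin n)) (hvhat : vhat = (lam⁻¹ : ℝ) • (v + z₀ - z₁)) :
    lam / 32 * ‖vhat‖ ^ 2 ≤
      (augLag f h A b c θ z₀ pm - augLag f h A b c θ z₁ p +
        (θ * (1 - θ)) / (2 * χ * c) * (‖p‖ ^ 2 - ‖pm‖ ^ 2)) +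
      ((2 - θ) * (1 - θ)) / (2 * χ * c) * ‖p - pm‖ ^ 2 - c / 4 * ‖A (z₁ - z₀)‖ ^ 2 := by
  have hlam0 : 0 < lam := by rw [hlam]; positivity
  have hlm : lam * m = 1 / 2 := by rw [hlam]; field_simp
  have hmid := augLag_midpoint_le hhconv hwc A b c θ pm hz₁ hz₀
  have hs := hsub ((1 / 2 : ℝ) • z₁ + (1 / 2 : ℝ) • z₀)
    (hhconv.1 hz₁ hz₀ (by norm_num) (by norm_num) (by norm_num))
  have hw₀ : (1 / 2 : ℝ) • z₁ + (1 / 2 : ℝ) • z₀ - z₀ = (1 / 2 : ℝ) • (z₁ - z₀) := by module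
  have hw₁ : (1 / 2 : ℝ) • z₁ + (1 / 2 : ℝ) • z₀ - z₁ = (-(1 / 2) : ℝ) • (z₁ - z₀) := by module
  rw [hw₀, hw₁, norm_smul, mul_pow, real_inner_smul_right] at hs
  norm_num at hs
  have hswap : ‖A (z₀ - z₁)‖ = ‖A (z₁ - z₀)‖ := by
    rw [← neg_sub z₁ z₀, map_neg, norm_neg]
  rw [norm_sub_rev z₀ z₁, hswap] at hmid
  have hv' : ‖v‖ ^ 2 ≤ ‖z₁ - z₀‖ ^ 2 / 4 := by
    have hle : ‖v‖ ≤ 1 / 2 * ‖z₁ - z₀‖ :=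
      hv.trans (mul_le_mul_of_nonneg_right hσ.2 (norm_nonneg _))
    nlinarith [norm_nonneg v]
  have hvh : lam ^ 2 * ‖vhat‖ ^ 2 = ‖v‖ ^ 2 - 2 * ⟪v, z₁ - z₀⟫ + ‖z₁ - z₀‖ ^ 2 := by
    rw [← norm_sub_sq_real, hvhat, norm_smul, mul_pow, Real.norm_eq_abs, sq_abs,
      show v + z₀ - z₁ = v - (z₁ - z₀) by abel]
    field_simp
  have hdescent : lam / 2 * ‖vhat‖ ^ 2 + c / 4 * ‖A (z₁ - z₀)‖ ^ 2 ≤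
      augLag f h A b c θ z₀ pm - augLag f h A b c θ z₁ pm := by
    refine le_of_mul_le_mul_left ?_ hlam0
    have hmid' := mul_le_mul_of_nonneg_left hmid hlam0.le
    have hlm' : lam * (m / 8 * ‖z₁ - z₀‖ ^ 2) = ‖z₁ - z₀‖ ^ 2 / 16 := by
      linear_combination ‖z₁ - z₀‖ ^ 2 / 8 * hlm
    rw [mul_sub, mul_add, hlm'] at hmid'
    linarith
  have hupd := augLag_sub_augLag_multiplier_update f h A b θ hc.ne' hχ.1.ne' z₁ hp
  have hnn : 0 ≤ lam * ‖vhat‖ ^ 2 := by positivity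
  linarith
end

section
/- Let A : ℝⁿ → ℝˡ be linear, b ∈ ℝˡ, c > 0, and let (χ, θ) ∈ (0,1)² satisfy 2(1−θ)(2−θ)χ ≤ θ². Suppose vectors p₀, p₁, p₂ ∈ ℝˡ and z₁, z₂ ∈ ℝⁿ satisfy pᵢ = (1−θ)pᵢ₋₁ + χ c (Azᵢ − b) for i = 1, 2. Then (b_θ/(2χc))‖p₂ − p₁‖² − (c/4)‖A(z₂ − z₁)‖² ≤ (α_{χ,θ}/(4χc)) (‖p₁ − p₀‖² − ‖p₂ − p₁‖²), where b_θ := (2−θ)(1−θ) and α_{χ,θ} := [(1 − 2χ b_θ) − (1−θ)²]/(2χ). -/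
open RealInnerProductSpace

/-- Let `A : ℝⁿ → ℝˡ` be linear, `b ∈ ℝˡ`, `c > 0`, and `(χ, θ) ∈ (0,1)²` with
`2(1−θ)(2−θ)χ ≤ θ²`.  If `pᵢ = (1−θ)pᵢ₋₁ + χc(Azᵢ − b)` for `i = 1, 2`, then
`(b_θ/(2χc))‖p₂ − p₁‖² − (c/4)‖A(z₂ − z₁)‖² ≤ (α_{χ,θ}/(4χc))(‖p₁ − p₀‖² − ‖p₂ − p₁‖²)`,
where `b_θ = (2−θ)(1−θ)` and `α_{χ,θ} = [(1 − 2χ b_θ) − (1−θ)²]/(2χ)`. -/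
theorem stmt_10 {n l : ℕ}
    (A : EuclideanSpace ℝ (Fin n) →L[ℝ] EuclideanSpace ℝ (Fin l))
    (b : EuclideanSpace ℝ (Fin l)) (c χ θ : ℝ) (hc : 0 < c)
    (hχ : χ ∈ Set.Ioo (0 : ℝ) 1) (hθ : θ ∈ Set.Ioo (0 : ℝ) 1)
    (hcond : 2 * (1 - θ) * (2 - θ) * χ ≤ θ ^ 2)
    (p₀ p₁ p₂ : EuclideanSpace ℝ (Fin l)) (z₁ z₂ : EuclideanSpace ℝ (Fin n))
    (h1 : p₁ = (1 - θ) • p₀ + (χ * c) • (A z₁ - b))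
    (h2 : p₂ = (1 - θ) • p₁ + (χ * c) • (A z₂ - b)) :
    ((2 - θ) * (1 - θ)) / (2 * χ * c) * ‖p₂ - p₁‖ ^ 2 - c / 4 * ‖A (z₂ - z₁)‖ ^ 2 ≤
      ((1 - 2 * χ * ((2 - θ) * (1 - θ)) - (1 - θ) ^ 2) / (2 * χ)) / (4 * χ * c) *
        (‖p₁ - p₀‖ ^ 2 - ‖p₂ - p₁‖ ^ 2) := by
  obtain ⟨hχ0, -⟩ := hχ
  obtain ⟨-, hθ1⟩ := hθ
  have hstep : (p₂ - p₁) - (1 - θ) • (p₁ - p₀) = (χ * c) • A (z₂ - z₁) := by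
    have e1 : (χ * c) • (A z₁ - b) = p₁ - (1 - θ) • p₀ := by rw [eq_sub_iff_add_eq', ← h1]
    have e2 : (χ * c) • (A z₂ - b) = p₂ - (1 - θ) • p₁ := by rw [eq_sub_iff_add_eq', ← h2]
    rw [map_sub, ← sub_sub_sub_cancel_right (A z₂) (A z₁) b, smul_sub (χ * c), e2, e1]
    module
  have hw := congrArg (fun v => ‖v‖ ^ 2) hstep
  simp only [norm_sub_sq_real (p₂ - p₁), norm_smul, mul_pow, Real.norm_eq_abs, sq_abs,
    inner_smul_right] at hw
  have hd := norm_sub_sq_real (p₂ - p₁) (p₁ - p₀)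
  have hd0 := sq_nonneg ‖(p₂ - p₁) - (p₁ - p₀)‖
  generalize inner ℝ (p₂ - p₁) (p₁ - p₀) = t at hw hd
  generalize ‖(p₂ - p₁) - (p₁ - p₀)‖ = r at hd hd0
  generalize ‖A (z₂ - z₁)‖ = w at hw ⊢
  generalize ‖p₂ - p₁‖ = x at hw hd ⊢
  generalize ‖p₁ - p₀‖ = y at hw hd ⊢
  have hgap : 0 ≤ (θ ^ 2 - 2 * (1 - θ) * (2 - θ) * χ) * (x ^ 2 + y ^ 2) +
      2 * (1 - θ) * r ^ 2 :=
    add_nonneg (mul_nonneg (sub_nonneg.2 hcond) (by positivity))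
      (mul_nonneg (by linarith) hd0)
  rw [hd] at hgap
  rw [← sub_nonneg]
  have hpos : 0 < 8 * χ ^ 2 * c := by positivity
  refine nonneg_of_mul_nonneg_right (hgap.trans_eq ?_) hpos
  field_simp
  linear_combination 16 * hw
end

section
/- Let h : ℝⁿ → (−∞, ∞] be proper, lower semicontinuous and convex, let f be differentiable on ℝⁿ, and suppose λ > 0 is such that the function λ L_c^θ(·; p₋) + (1/2)‖· − z₀‖² is convex (e.g. λ m ≤ 1 where −(m/2)‖u−z‖² ≤ f(u)−f(z)−⟨∇f(z),u−z⟩ for all u,z). Suppose v ∈ ∂(λ L_c^θ(·; p₋) + (1/2)‖· − z₀‖²)(z₁). Then v̂ := (v + z₀ − z₁)/λ satisfies v̂ ∈ ∇f(z₁) + ∂h(z₁) + A*p̂, where p̂ := (1−θ)p₋ + c(Az₁ − b). Moreover, if χ ∈ (0,1), p := (1−θ)p₋ + χ c (Az₁ − b), and ‖p‖ ≤ B_p and ‖p₋‖ ≤ B_p for some B_p ≥ 0, then ‖Az₁ − b‖ ≤ 2B_p/(χ c). -/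
open RealInnerProductSpace
open scoped Classical

/-- First-order optimality for a sum of a differentiable and a convex function: if `g + h` is
minimized over `D` at `x`, then `-g' ∈ ∂h(x)`. -/
theorem ConvexOn.sub_fderiv_le_of_isMinOn_add {E : Type*} [NormedAddCommGroup E] [NormedSpace ℝ E]
    {D : Set E} {g h : E → ℝ} {g' : E →L[ℝ] ℝ} {x y : E} (hh : ConvexOn ℝ D h)
    (hg : HasFDerivAt g g' x) (hx : x ∈ D) (hmin : IsMinOn (fun z => g z + h z) D x)
    (hy : y ∈ D) : h x - g' (y - x) ≤ h y := by
  set ψ : ℝ → ℝ := fun t => g (x + t • (y - x)) + t * (h y - h x) with hψ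
  have hline : HasDerivAt (fun t : ℝ => x + t • (y - x)) (y - x) 0 := by
    simpa using ((hasDerivAt_id (0 : ℝ)).smul_const (y - x)).const_add x
  have hder : HasDerivAt ψ (g' (y - x) + (h y - h x)) 0 := by
    have hg0 : HasFDerivAt g g' (x + (0 : ℝ) • (y - x)) := by simpa using hg
    have hlin : HasDerivAt (fun t : ℝ => t * (h y - h x)) (h y - h x) 0 := by
      simpa using (hasDerivAt_id (0 : ℝ)).mul_const (h y - h x)
    exact (hg0.comp_hasDerivAt 0 hline).add hlin
  have hψmin : IsMinOn ψ (Set.Icc 0 1) 0 := by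
    intro t ht
    have hcomb : x + t • (y - x) = (1 - t) • x + t • y := by module
    have hmem : x + t • (y - x) ∈ D :=
      hcomb ▸ hh.1 hx hy (sub_nonneg.2 ht.2) ht.1 (by ring)
    have hle : h (x + t • (y - x)) ≤ (1 - t) * h x + t * h y := by
      simpa [hcomb] using hh.2 hx hy (sub_nonneg.2 ht.2) ht.1 (by ring)
    have hm : g x + h x ≤ g (x + t • (y - x)) + h (x + t • (y - x)) := hmin hmem
    simp only [hψ, Set.mem_ofPred_eq, zero_smul, add_zero, zero_mul]
    linarith
  have hcone : (1 : ℝ) ∈ posTangentConeAt (Set.Icc (0 : ℝ) 1) 0 :=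
    mem_posTangentConeAt_of_segment_subset (by simp [segment_eq_Icc])
  have hnonneg := hψmin.localize.hasFDerivWithinAt_nonneg
    hder.hasFDerivAt.hasFDerivWithinAt hcone
  simp only [ContinuousLinearMap.toSpanSingleton_apply, one_smul] at hnonneg
  linarith

/-- Let `h` be proper lsc convex (encoded by a real-valued `h` on its effective
domain `D`), `f` differentiable on `ℝⁿ`, and `λ > 0` such that `λ L_c^θ(·; p₋) + (1/2)‖· − z₀‖²`
is convex.  If `v ∈ ∂(λ L_c^θ(·; p₋) + (1/2)‖· − z₀‖²)(z₁)`, then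
`v̂ = (v + z₀ − z₁)/λ ∈ ∇f(z₁) + ∂h(z₁) + A*p̂` where `p̂ = (1−θ)p₋ + c(Az₁ − b)`.
Moreover, if `χ ∈ (0,1)`, `p = (1−θ)p₋ + χc(Az₁ − b)`, and `‖p‖ ≤ B_p`, `‖p₋‖ ≤ B_p`, then
`‖Az₁ − b‖ ≤ 2B_p/(χc)`. -/
theorem stmt_11 {n l : ℕ} (h : EuclideanSpace ℝ (Fin n) → ℝ)
    (D : Set (EuclideanSpace ℝ (Fin n))) (hDne : D.Nonempty) (hhconv : ConvexOn ℝ D h)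
    (hhlsc : LowerSemicontinuous fun x => if x ∈ D then ((h x : ℝ) : EReal) else (⊤ : EReal))
    (f : EuclideanSpace ℝ (Fin n) → ℝ) (f' : EuclideanSpace ℝ (Fin n) → EuclideanSpace ℝ (Fin n))
    (hf : ∀ x, HasGradientAt f (f' x) x)
    (lam c θ : ℝ) (hlam : 0 < lam) (hc : 0 < c) (hθ : θ ∈ Set.Ioo (0 : ℝ) 1)
    (A : EuclideanSpace ℝ (Fin n) →L[ℝ] EuclideanSpace ℝ (Fin l))
    (b pm : EuclideanSpace ℝ (Fin l)) (z₀ : EuclideanSpace ℝ (Fin n))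
    (hconvex : ConvexOn ℝ D fun z => lam * augLag f h A b c θ z pm + 1 / 2 * ‖z - z₀‖ ^ 2)
    (z₁ : EuclideanSpace ℝ (Fin n)) (hz₁ : z₁ ∈ D) (v : EuclideanSpace ℝ (Fin n))
    (hsub : ∀ z' ∈ D,
      lam * augLag f h A b c θ z' pm + 1 / 2 * ‖z' - z₀‖ ^ 2 ≥
        lam * augLag f h A b c θ z₁ pm + 1 / 2 * ‖z₁ - z₀‖ ^ 2 + ⟪v, z' - z₁⟫)
    (vhat : EuclideanSpace ℝ (Fin n)) (hvhat : vhat = (lam⁻¹ : ℝ) • (v + z₀ - z₁))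
    (phat : EuclideanSpace ℝ (Fin l)) (hphat : phat = (1 - θ) • pm + c • (A z₁ - b)) :
    (∃ s, (∀ z' ∈ D, h z' ≥ h z₁ + ⟪s, z' - z₁⟫) ∧
        vhat = f' z₁ + s + (ContinuousLinearMap.adjoint A) phat) ∧
      (∀ χ : ℝ, ∀ p : EuclideanSpace ℝ (Fin l), ∀ Bp : ℝ, χ ∈ Set.Ioo (0 : ℝ) 1 →
        p = (1 - θ) • pm + (χ * c) • (A z₁ - b) → ‖p‖ ≤ Bp → ‖pm‖ ≤ Bp →
        ‖A z₁ - b‖ ≤ 2 * Bp / (χ * c)) := by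
  refine ⟨⟨vhat - f' z₁ - ContinuousLinearMap.adjoint A phat, fun z' hz' => ?_, by abel⟩, ?_⟩
  · set g : EuclideanSpace ℝ (Fin n) → ℝ := fun z =>
      f z + (1 - θ) * ⟪pm, A z - b⟫ + c / 2 * ‖A z - b‖ ^ 2
        + lam⁻¹ * (1 / 2 * ‖z - z₀‖ ^ 2 - ⟪v, z⟫) with hg
    have hAb : HasFDerivAt (fun z => A z - b) A z₁ := A.hasFDerivAt.sub_const b
    have hder := (((hf z₁).hasFDerivAt.add
      (((hasFDerivAt_const pm z₁).inner ℝ hAb).const_mul (1 - θ))).add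
      (hAb.norm_sq.const_mul (c / 2))).add
      (((((hasFDerivAt_id z₁).sub_const z₀).norm_sq.const_mul (1 / 2)).sub
        ((hasFDerivAt_const v z₁).inner ℝ (hasFDerivAt_id z₁))).const_mul lam⁻¹)
    have hmin : IsMinOn (fun z => g z + h z) D z₁ := by
      intro z hz
      have hs := mul_le_mul_of_nonneg_left (hsub z hz) (inv_pos.2 hlam).le
      simp only [augLag, inner_sub_right v, mul_add, inv_mul_cancel_left₀ hlam.ne'] at hs
      simp only [hg, Set.mem_ofPred_eq]
      linarith
    have key := hhconv.sub_fderiv_le_of_isMinOn_add (g := g) hder hz₁ hmin hz'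
    refine ge_iff_le.2 (le_trans (le_of_eq ?_) key)
    subst hvhat hphat
    simp [inner_sub_left, inner_add_left, inner_smul_left,
      ContinuousLinearMap.adjoint_inner_left]
    ring
  · rintro χ p Bp ⟨hχ, -⟩ hp hpB hpmB
    have hχc : 0 < χ * c := mul_pos hχ hc
    rw [le_div_iff₀ hχc]
    calc ‖A z₁ - b‖ * (χ * c) = ‖p - (1 - θ) • pm‖ := by
          rw [hp, add_sub_cancel_left, norm_smul, Real.norm_of_nonneg hχc.le, mul_comm]
      _ ≤ ‖p‖ + (1 - θ) * ‖pm‖ := by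
          refine (norm_sub_le _ _).trans_eq ?_
          rw [norm_smul, Real.norm_of_nonneg (sub_nonneg.2 hθ.2.le)]
      _ ≤ 2 * Bp := by nlinarith [norm_nonneg pm, hθ.1]
end

section
/- Let h : ℝⁿ → (−∞, ∞] be proper, lower semicontinuous and convex, and let f be differentiable on ℝⁿ with −(m/2)‖u−z‖² ≤ f(u) − f(z) − ⟨∇f(z), u−z⟩ for all u, z and some m > 0. Let λ = 1/(2m), σ ∈ (0, 1/2], c > 0, and let (χ, θ) ∈ (0,1)² satisfy 2(1−θ)(2−θ)χ ≤ θ². Let integers j < k, a vector p_{j−1} ∈ ℝˡ, and sequences z_j, …, z_k ∈ dom h, p_j, …, p_k ∈ ℝˡ, v_{j+1}, …, v_k ∈ ℝⁿ be such that pᵢ = (1−θ)pᵢ₋₁ + χ c (Azᵢ − b) for i = j, …, k, and vᵢ ∈ ∂(λ L_c^θ(·; pᵢ₋₁) + (1/2)‖· − zᵢ₋₁‖²)(zᵢ) with ‖vᵢ‖ ≤ σ‖zᵢ − zᵢ₋₁‖ for i = j+1, …, k. Define v̂ᵢ := (vᵢ + zᵢ₋₁ − zᵢ)/λ and Ψᵢ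 := L_c^θ(zᵢ; pᵢ) − (a_θ/(2χc))‖pᵢ‖² + (α_{χ,θ}/(4χc))‖pᵢ − pᵢ₋₁‖². Then λ Σ_{i=j+1}^{k} ‖v̂ᵢ‖² ≤ 32 (Ψ_j − Ψ_k). -/
open RealInnerProductSpace
open scoped Classical

/-- The potential `Ψ = L_c^θ(z; p) − (a_θ/(2χc))‖p‖² + (α_{χ,θ}/(4χc))‖p − p₋‖²`, where
`a_θ = θ(1−θ)`, `b_θ = (2−θ)(1−θ)` and `α_{χ,θ} = [(1 − 2χ b_θ) − (1−θ)²]/(2χ)`. -/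
noncomputable def potential {n l : ℕ} (f h : EuclideanSpace ℝ (Fin n) → ℝ)
    (A : EuclideanSpace ℝ (Fin n) →L[ℝ] EuclideanSpace ℝ (Fin l))
    (b : EuclideanSpace ℝ (Fin l)) (c χ θ : ℝ) (z : EuclideanSpace ℝ (Fin n))
    (p pPrev : EuclideanSpace ℝ (Fin l)) : ℝ :=
  augLag f h A b c θ z p - (θ * (1 - θ)) / (2 * χ * c) * ‖p‖ ^ 2 +
    ((1 - 2 * χ * ((2 - θ) * (1 - θ)) - (1 - θ) ^ 2) / (2 * χ)) / (4 * χ * c) * ‖p - pPrev‖ ^ 2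

lemma norm_sq_segment {E : Type*} [NormedAddCommGroup E] [InnerProductSpace ℝ E] (x y : E)
    (t : ℝ) :
    ‖(1 - t) • x + t • y‖ ^ 2 =
      (1 - t) * ‖x‖ ^ 2 + t * ‖y‖ ^ 2 - t * (1 - t) * ‖y - x‖ ^ 2 := by
  rw [norm_add_sq_real, norm_sub_sq_real, norm_smul, norm_smul, mul_pow, mul_pow,
    real_inner_smul_left, real_inner_smul_right, Real.norm_eq_abs, Real.norm_eq_abs, sq_abs,
    sq_abs, real_inner_comm]
  ring

lemma le_segment_of_lower_quadratic {E : Type*} [NormedAddCommGroup E] [InnerProductSpace ℝ E]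
    {f : E → ℝ} {f' : E → E} {m : ℝ}
    (hwc : ∀ u z, -(m / 2) * ‖u - z‖ ^ 2 ≤ f u - f z - ⟪f' z, u - z⟫) (x y : E) {t : ℝ}
    (ht0 : 0 ≤ t) (ht1 : t ≤ 1) :
    f ((1 - t) • x + t • y) ≤
      (1 - t) * f x + t * f y + m / 2 * (t * (1 - t)) * ‖y - x‖ ^ 2 := by
  set w := (1 - t) • x + t • y with hw
  have hx : x - w = (-t) • (y - x) := by rw [hw]; module
  have hy : y - w = (1 - t) • (y - x) := by rw [hw]; module
  have h1 := hwc x w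
  have h2 := hwc y w
  rw [hx, norm_smul, mul_pow, Real.norm_eq_abs, sq_abs, real_inner_smul_right] at h1
  rw [hy, norm_smul, mul_pow, Real.norm_eq_abs, sq_abs, real_inner_smul_right] at h2
  linarith [mul_le_mul_of_nonneg_left h1 (sub_nonneg.2 ht1), mul_le_mul_of_nonneg_left h2 ht0]

lemma augLag_segment_le {n l : ℕ} {f h : EuclideanSpace ℝ (Fin n) → ℝ}
    {f' : EuclideanSpace ℝ (Fin n) → EuclideanSpace ℝ (Fin n)}
    {D : Set (EuclideanSpace ℝ (Fin n))} (hhconv : ConvexOn ℝ D h) {m : ℝ}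
    (hwc : ∀ u z, -(m / 2) * ‖u - z‖ ^ 2 ≤ f u - f z - ⟪f' z, u - z⟫)
    (A : EuclideanSpace ℝ (Fin n) →L[ℝ] EuclideanSpace ℝ (Fin l))
    (b : EuclideanSpace ℝ (Fin l)) (c θ : ℝ) (p : EuclideanSpace ℝ (Fin l))
    {x y : EuclideanSpace ℝ (Fin n)} (hx : x ∈ D) (hy : y ∈ D) {t : ℝ}
    (ht0 : 0 ≤ t) (ht1 : t ≤ 1) :
    augLag f h A b c θ ((1 - t) • x + t • y) p ≤
      (1 - t) * augLag f h A b c θ x p + t * augLag f h A b c θ y p +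
        t * (1 - t) * (m / 2 * ‖y - x‖ ^ 2 - c / 2 * ‖A (y - x)‖ ^ 2) := by
  have h1 := le_segment_of_lower_quadratic hwc x y ht0 ht1
  have h2 := hhconv.2 hx hy (sub_nonneg.2 ht1) ht0 (by ring)
  have h3 : A ((1 - t) • x + t • y) - b = (1 - t) • (A x - b) + t • (A y - b) := by
    rw [map_add, map_smul, map_smul]; module
  have h4 : (A y - b) - (A x - b) = A (y - x) := by rw [map_sub]; module
  simp only [smul_eq_mul] at h2
  simp only [augLag]
  rw [h3, norm_sq_segment, h4, inner_add_right, real_inner_smul_right, real_inner_smul_right]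
  linarith

lemma le_of_forall_one_sub_mul_le {X Y : ℝ} (H : ∀ t : ℝ, 0 < t → t < 1 → (1 - t) * Y ≤ X) :
    Y ≤ X := by
  have hlim : Filter.Tendsto (fun t : ℝ => (1 - t) * Y) (nhdsWithin 0 (Set.Ioi 0)) (nhds Y) := by
    have hcont : Continuous fun t : ℝ => (1 - t) * Y := by fun_prop
    simpa using (hcont.tendsto 0).mono_left nhdsWithin_le_nhds
  refine le_of_tendsto hlim ?_
  filter_upwards [Ioo_mem_nhdsGT (zero_lt_one (α := ℝ))] with t ht using H t ht.1 ht.2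

/-- An inexact proximal subgradient inequality improves by the strong convexity of the prox
subproblem. -/
lemma prox_descent {n l : ℕ} {f h : EuclideanSpace ℝ (Fin n) → ℝ}
    {f' : EuclideanSpace ℝ (Fin n) → EuclideanSpace ℝ (Fin n)}
    {D : Set (EuclideanSpace ℝ (Fin n))} (hhconv : ConvexOn ℝ D h) {m : ℝ}
    (hwc : ∀ u z, -(m / 2) * ‖u - z‖ ^ 2 ≤ f u - f z - ⟪f' z, u - z⟫)
    (A : EuclideanSpace ℝ (Fin n) →L[ℝ] EuclideanSpace ℝ (Fin l))
    (b : EuclideanSpace ℝ (Fin l)) (c θ : ℝ) (p : EuclideanSpace ℝ (Fin l))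
    {lam : ℝ} (hlam : 0 ≤ lam) {x y v : EuclideanSpace ℝ (Fin n)} (hx : x ∈ D) (hy : y ∈ D)
    (hsub : ∀ z' ∈ D, lam * augLag f h A b c θ z' p + 1 / 2 * ‖z' - y‖ ^ 2 ≥
      lam * augLag f h A b c θ x p + 1 / 2 * ‖x - y‖ ^ 2 + ⟪v, z' - x⟫) :
    lam * augLag f h A b c θ x p + (1 - lam * m / 2) * ‖x - y‖ ^ 2 +
        lam * (c / 2) * ‖A (x - y)‖ ^ 2 - ⟪v, x - y⟫ ≤ lam * augLag f h A b c θ y p := by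
  have hnorm : ‖y - x‖ = ‖x - y‖ := norm_sub_rev y x
  have hA : ‖A (y - x)‖ = ‖A (x - y)‖ := by rw [map_sub, map_sub, norm_sub_rev]
  have hinner : ⟪v, y - x⟫ = -⟪v, x - y⟫ := by rw [← inner_neg_right, neg_sub]
  suffices H : (1 - lam * m) / 2 * ‖x - y‖ ^ 2 + lam * (c / 2) * ‖A (x - y)‖ ^ 2 ≤
      lam * augLag f h A b c θ y p - lam * augLag f h A b c θ x p - 1 / 2 * ‖x - y‖ ^ 2 +
        ⟪v, x - y⟫ by linarith
  refine le_of_forall_one_sub_mul_le fun t ht0 ht1 => ?_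
  have h1 := hsub _ (hhconv.1 hx hy (sub_nonneg.2 ht1.le) ht0.le (by ring))
  have h2 := mul_le_mul_of_nonneg_left
    (augLag_segment_le hhconv hwc A b c θ p hx hy ht0.le ht1.le) hlam
  have h3 : (1 - t) • x + t • y - y = (1 - t) • (x - y) := by module
  have h4 : (1 - t) • x + t • y - x = t • (y - x) := by module
  rw [h3, h4, norm_smul, mul_pow, Real.norm_eq_abs, sq_abs, real_inner_smul_right, hinner] at h1
  rw [hnorm, hA] at h2
  refine le_of_mul_le_mul_left ?_ ht0
  linarith

lemma damped_quadratic_nonneg {E : Type*} [NormedAddCommGroup E] [InnerProductSpace ℝ E]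
    {θ β : ℝ} (hθ1 : θ ≤ 1) (hβ : 2 * β ≤ θ ^ 2) (x y : E) :
    0 ≤ ‖x - (1 - θ) • y‖ ^ 2 - β * ‖x‖ ^ 2 +
      (1 - 2 * β - (1 - θ) ^ 2) / 4 * (‖y‖ ^ 2 - ‖x‖ ^ 2) := by
  have hs : 0 ≤ 1 - θ := sub_nonneg.2 hθ1
  have hxy := real_inner_le_norm x y
  rw [norm_sub_sq_real, norm_smul, mul_pow, Real.norm_eq_abs, sq_abs, real_inner_smul_right]
  have h1 := mul_le_mul_of_nonneg_left hxy hs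
  have h2 := mul_le_mul_of_nonneg_right hβ (by positivity : 0 ≤ ‖x‖ ^ 2 + ‖y‖ ^ 2)
  have h3 : 0 ≤ (2 - θ) / 2 * (‖x‖ ^ 2 + (1 - θ) * ‖y‖ ^ 2) - 2 * (1 - θ) * (‖x‖ * ‖y‖) := by
    refine nonneg_of_mul_nonneg_right ?_ (by linarith : 0 < 2 * (2 - θ))
    have h4 : 0 ≤ ((2 - θ) * ‖x‖ - 2 * (1 - θ) * ‖y‖) ^ 2 + (1 - θ) * (θ * ‖y‖) ^ 2 := by
      positivity
    linarith
  linarith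

lemma inner_sub_damped {E : Type*} [NormedAddCommGroup E] [InnerProductSpace ℝ E]
    (θ : ℝ) (p q : E) :
    ⟪p - q, p - (1 - θ) • q⟫ =
      θ / 2 * (‖p‖ ^ 2 - ‖q‖ ^ 2) + (2 - θ) / 2 * ‖p - q‖ ^ 2 := by
  rw [norm_sub_sq_real, inner_sub_left, inner_sub_right, inner_sub_right, real_inner_smul_right,
    real_inner_smul_right, real_inner_self_eq_norm_sq, real_inner_self_eq_norm_sq,
    real_inner_comm p q]
  ring

/-- Up to the loss `(c/2)‖A(z − z₋)‖²`, the multiplier update preserves the decrease of the augmented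
Lagrangian at a fixed multiplier as a decrease of the potential. -/
lemma potential_sub_ge {n l : ℕ} (f h : EuclideanSpace ℝ (Fin n) → ℝ)
    (A : EuclideanSpace ℝ (Fin n) →L[ℝ] EuclideanSpace ℝ (Fin l))
    (b : EuclideanSpace ℝ (Fin l)) {c χ θ : ℝ} (hc : 0 < c) (hχ : 0 < χ) (hθ1 : θ ≤ 1)
    (hcond : 2 * (1 - θ) * (2 - θ) * χ ≤ θ ^ 2)
    {x y : EuclideanSpace ℝ (Fin n)} {p q r : EuclideanSpace ℝ (Fin l)}
    (hp : p = (1 - θ) • q + (χ * c) • (A x - b))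
    (hq : q = (1 - θ) • r + (χ * c) • (A y - b)) :
    augLag f h A b c θ y q - augLag f h A b c θ x q - c / 2 * ‖A (x - y)‖ ^ 2 ≤
      potential f h A b c χ θ y q r - potential f h A b c χ θ x p q := by
  have hAx : (χ * c) • (A x - b) = p - (1 - θ) • q := by rw [hp]; module
  have hAy : (χ * c) • (A y - b) = q - (1 - θ) • r := by rw [hq]; module
  have hAxy : (χ * c) • A (x - y) = (p - q) - (1 - θ) • (q - r) := by
    have : (χ * c) • A (x - y) = (χ * c) • (A x - b) - (χ * c) • (A y - b) := by
      rw [map_sub]; module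
    rw [this, hAx, hAy]; module
  have hL : augLag f h A b c θ x p =
      augLag f h A b c θ x q + (1 - θ) * ⟪p - q, A x - b⟫ := by
    simp only [augLag, inner_sub_left p q]; ring
  have hI : ⟪p - q, A x - b⟫ =
      (θ / 2 * (‖p‖ ^ 2 - ‖q‖ ^ 2) + (2 - θ) / 2 * ‖p - q‖ ^ 2) / (χ * c) := by
    rw [← inner_sub_damped, ← hAx, real_inner_smul_right]; field_simp
  have hN : ‖A (x - y)‖ ^ 2 = ‖(p - q) - (1 - θ) • (q - r)‖ ^ 2 / (χ * c) ^ 2 := by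
    rw [← hAxy, norm_smul, mul_pow, Real.norm_eq_abs, sq_abs]; field_simp
  have hQ := damped_quadratic_nonneg hθ1 (β := χ * ((2 - θ) * (1 - θ))) (by linarith)
    (p - q) (q - r)
  have hQ' := div_nonneg hQ (by positivity : 0 ≤ 2 * χ ^ 2 * c)
  rw [← sub_nonneg]
  refine hQ'.trans_eq ?_
  simp only [potential]
  rw [hL, hI, hN]
  field_simp
  ring

lemma sum_Icc_le_sub_of_le_sub {a F : ℤ → ℝ} {j k : ℤ} (hjk : j ≤ k)
    (H : ∀ i, j + 1 ≤ i → i ≤ k → a i ≤ F (i - 1) - F i) :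
    ∑ i ∈ Finset.Icc (j + 1) k, a i ≤ F j - F k := by
  induction k, hjk using Int.leInduction with
  | base => simp
  | succ k hk ih =>
    have hIcc : Finset.Icc (j + 1) (k + 1) = insert (k + 1) (Finset.Icc (j + 1) k) := by
      ext i; simp only [Finset.mem_Icc, Finset.mem_insert]; omega
    have hlast := H (k + 1) (by omega) le_rfl
    rw [add_sub_cancel_right] at hlast
    rw [hIcc, Finset.sum_insert (by simp)]
    linarith [ih fun i hi hik => H i hi (by omega)]

/-- In the AIDAL setting with `λ = 1/(2m)`, `σ ∈ (0,1/2]`, `c > 0`,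
`(χ, θ) ∈ (0,1)²` with `2(1−θ)(2−θ)χ ≤ θ²`: given integers `j < k` and sequences satisfying the
multiplier updates `pᵢ = (1−θ)pᵢ₋₁ + χc(Azᵢ − b)` for `i = j, …, k` and the inexact prox
conditions `vᵢ ∈ ∂(λ L_c^θ(·; pᵢ₋₁) + (1/2)‖· − zᵢ₋₁‖²)(zᵢ)`, `‖vᵢ‖ ≤ σ‖zᵢ − zᵢ₋₁‖` for
`i = j+1, …, k`, the refined residuals `v̂ᵢ = (vᵢ + zᵢ₋₁ − zᵢ)/λ` satisfy
`λ Σ_{i=j+1}^{k} ‖v̂ᵢ‖² ≤ 32 (Ψ_j − Ψ_k)`. -/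
theorem stmt_12 {n l : ℕ} (h : EuclideanSpace ℝ (Fin n) → ℝ)
    (D : Set (EuclideanSpace ℝ (Fin n))) (hDne : D.Nonempty) (hhconv : ConvexOn ℝ D h)
    (hhlsc : LowerSemicontinuous fun x => if x ∈ D then ((h x : ℝ) : EReal) else (⊤ : EReal))
    (f : EuclideanSpace ℝ (Fin n) → ℝ) (f' : EuclideanSpace ℝ (Fin n) → EuclideanSpace ℝ (Fin n))
    (hf : ∀ x, HasGradientAt f (f' x) x)
    (m : ℝ) (hm : 0 < m)
    (hwc : ∀ u z, -(m / 2) * ‖u - z‖ ^ 2 ≤ f u - f z - ⟪f' z, u - z⟫)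
    (lam σ c χ θ : ℝ) (hlam : lam = 1 / (2 * m)) (hσ : σ ∈ Set.Ioc (0 : ℝ) (1 / 2)) (hc : 0 < c)
    (hχ : χ ∈ Set.Ioo (0 : ℝ) 1) (hθ : θ ∈ Set.Ioo (0 : ℝ) 1)
    (hcond : 2 * (1 - θ) * (2 - θ) * χ ≤ θ ^ 2)
    (A : EuclideanSpace ℝ (Fin n) →L[ℝ] EuclideanSpace ℝ (Fin l))
    (b : EuclideanSpace ℝ (Fin l))
    (j k : ℤ) (hjk : j < k)
    (z : ℤ → EuclideanSpace ℝ (Fin n)) (p : ℤ → EuclideanSpace ℝ (Fin l))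
    (v : ℤ → EuclideanSpace ℝ (Fin n))
    (hzD : ∀ i, j ≤ i → i ≤ k → z i ∈ D)
    (hp : ∀ i, j ≤ i → i ≤ k → p i = (1 - θ) • p (i - 1) + (χ * c) • (A (z i) - b))
    (hsub : ∀ i, j + 1 ≤ i → i ≤ k → ∀ z' ∈ D,
      lam * augLag f h A b c θ z' (p (i - 1)) + 1 / 2 * ‖z' - z (i - 1)‖ ^ 2 ≥
        lam * augLag f h A b c θ (z i) (p (i - 1)) + 1 / 2 * ‖z i - z (i - 1)‖ ^ 2 +
          ⟪v i, z' - z i⟫)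
    (hv : ∀ i, j + 1 ≤ i → i ≤ k → ‖v i‖ ≤ σ * ‖z i - z (i - 1)‖) :
    lam * ∑ i ∈ Finset.Icc (j + 1) k, ‖(lam⁻¹ : ℝ) • (v i + z (i - 1) - z i)‖ ^ 2 ≤
      32 * (potential f h A b c χ θ (z j) (p j) (p (j - 1)) -
            potential f h A b c χ θ (z k) (p k) (p (k - 1))) := by
  have hlam0 : 0 < lam := by rw [hlam]; positivity
  have hlm : lam * m = 1 / 2 := by rw [hlam]; field_simp
  rw [Finset.mul_sum, mul_sub]
  refine sum_Icc_le_sub_of_le_sub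
    (F := fun i => 32 * potential f h A b c χ θ (z i) (p i) (p (i - 1))) hjk.le fun i hi hik => ?_
  have hdesc := prox_descent hhconv hwc A b c θ (p (i - 1)) hlam0.le (hzD i (by omega) hik)
    (hzD (i - 1) (by omega) (by omega)) (hsub i hi hik)
  have hpot := mul_le_mul_of_nonneg_left
    (potential_sub_ge f h A b hc hχ.1 hθ.2.le hcond (hp i (by omega) hik)
      (hp (i - 1) (by omega) (by omega))) hlam0.le
  have hvi : ‖v i‖ ≤ 1 / 2 * ‖z i - z (i - 1)‖ :=
    (hv i hi hik).trans (mul_le_mul_of_nonneg_right hσ.2 (norm_nonneg _))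
  have hinner : ⟪v i, z i - z (i - 1)⟫ ≤ 1 / 2 * ‖z i - z (i - 1)‖ ^ 2 := by
    refine (real_inner_le_norm _ _).trans ?_
    linarith [mul_le_mul_of_nonneg_right hvi (norm_nonneg (z i - z (i - 1)))]
  have hres : ‖v i + z (i - 1) - z i‖ ≤ 3 / 2 * ‖z i - z (i - 1)‖ := by
    have hsplit : v i + z (i - 1) - z i = v i - (z i - z (i - 1)) := by abel
    rw [hsplit]
    linarith [norm_sub_le (v i) (z i - z (i - 1))]
  have hres2 := pow_le_pow_left₀ (norm_nonneg _) hres 2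
  have hnorm : lam * ‖(lam⁻¹ : ℝ) • (v i + z (i - 1) - z i)‖ ^ 2 =
      ‖v i + z (i - 1) - z i‖ ^ 2 / lam := by
    rw [norm_smul, mul_pow, Real.norm_eq_abs, sq_abs]; field_simp
  rw [hnorm, div_le_iff₀ hlam0]
  rw [hlm] at hdesc
  linarith [sq_nonneg ‖z i - z (i - 1)‖]
end

section
/- Let h : ℝⁿ → (−∞, ∞] be proper, lower semicontinuous, convex, with compact domain H := dom h of diameter D_h, let f be differentiable on H with sup_{u∈H} ‖∇f(u)‖ =: G_f < ∞, and let A : ℝⁿ → ℝˡ be a nonzero linear operator with smallest positive singular value σ_A⁺. Let λ > 0, σ > 0, z ∈ H, z₋ ∈ H, and v̂, p̂, ξ satisfy: ξ := v̂ − ∇f(z) − A*p̂ belongs to ∂h(z), ‖v̂‖ ≤ (1+σ)‖z − z₋‖/λ, and p̂ lies in the range of A (equivalently, p̂ is orthogonal to ker A*). Then ‖p̂‖ ≤ (1/σ_A⁺) [ ‖ξ‖ + G_f + (1+σ) D_h / λ ]. -/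
open RealInnerProductSpace
open scoped Classical

/-- If `σ ^ 2` is a lower bound for the positive eigenvalues of `A* A`, then `A*` expands the norm
on the range of `A` by a factor of at least `σ`. -/
theorem mul_norm_le_norm_adjoint_of_eigenvalue_bound {E F : Type*}
    [NormedAddCommGroup E] [InnerProductSpace ℝ E] [FiniteDimensional ℝ E] [CompleteSpace E]
    [NormedAddCommGroup F] [InnerProductSpace ℝ F] [CompleteSpace F]
    (A : E →L[ℝ] F) {σ : ℝ}
    (hσ : ∀ μ : ℝ, 0 < μ → ∀ w : E, w ≠ 0 →
      ContinuousLinearMap.adjoint A (A w) = μ • w → σ ^ 2 ≤ μ) (w : E) :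
    σ * ‖A w‖ ≤ ‖ContinuousLinearMap.adjoint A (A w)‖ := by
  set T : E →ₗ[ℝ] E := ((ContinuousLinearMap.adjoint A).comp A).toLinearMap
  have hT : ∀ x, T x = ContinuousLinearMap.adjoint A (A x) := fun _ => rfl
  have hsymm : T.IsSymmetric := fun x y => by
    rw [hT, hT, ContinuousLinearMap.adjoint_inner_left, ContinuousLinearMap.adjoint_inner_right]
  set b := hsymm.eigenvectorBasis rfl
  set μ := hsymm.eigenvalues rfl
  have hb : ∀ i, T (b i) = μ i • b i := fun i => hsymm.apply_eigenvectorBasis rfl i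
  have hμ : ∀ i, 0 ≤ μ i := fun i => by
    have h : ⟪T (b i), b i⟫ = μ i := by
      rw [hb, real_inner_smul_left, real_inner_self_eq_norm_sq, b.norm_eq_one]
      ring
    rw [← h, hT, ContinuousLinearMap.adjoint_inner_left]
    exact real_inner_self_nonneg
  have hcoord : ∀ i, ⟪b i, T w⟫ = μ i * ⟪b i, w⟫ := fun i => by
    rw [← hsymm, hb, real_inner_smul_left]
  have hA : ‖A w‖ ^ 2 = ∑ i, μ i * ⟪b i, w⟫ ^ 2 := by
    rw [← real_inner_self_eq_norm_sq, ← ContinuousLinearMap.adjoint_inner_right, ← hT,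
      ← b.sum_inner_mul_inner]
    refine Finset.sum_congr rfl fun i _ => ?_
    rw [hcoord, real_inner_comm]
    ring
  have hTw : ‖T w‖ ^ 2 = ∑ i, μ i ^ 2 * ⟪b i, w⟫ ^ 2 := by
    rw [← real_inner_self_eq_norm_sq, ← b.sum_inner_mul_inner]
    refine Finset.sum_congr rfl fun i _ => ?_
    rw [real_inner_comm, hcoord]
    ring
  rw [← hT]
  refine le_of_abs_le (abs_le_of_sq_le_sq ?_ (norm_nonneg _))
  rw [mul_pow, hA, hTw, Finset.mul_sum]
  refine Finset.sum_le_sum fun i _ => ?_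
  rcases (hμ i).eq_or_lt with h0 | hpos
  · simp [← h0]
  · have hle := hσ (μ i) hpos (b i) (b.orthonormal.ne_zero i) (hb i)
    calc σ ^ 2 * (μ i * ⟪b i, w⟫ ^ 2) ≤ μ i * (μ i * ⟪b i, w⟫ ^ 2) := by gcongr
      _ = μ i ^ 2 * ⟪b i, w⟫ ^ 2 := by ring

/-- Let `h` be proper lsc convex with compact effective domain `H` of diameter
`D_h`, let `f` be differentiable on `H` with `G_f = sup_{u ∈ H} ‖∇f(u)‖`, and let `A` be a
nonzero linear operator with smallest positive singular value `σ_A⁺`.  If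
`ξ = v̂ − ∇f(z) − A*p̂ ∈ ∂h(z)`, `‖v̂‖ ≤ (1+σ)‖z − z₋‖/λ`, and `p̂` lies in the range of `A`,
then `‖p̂‖ ≤ (1/σ_A⁺)[‖ξ‖ + G_f + (1+σ)D_h/λ]`. -/
theorem stmt_13 {n l : ℕ} (h : EuclideanSpace ℝ (Fin n) → ℝ)
    (H : Set (EuclideanSpace ℝ (Fin n))) (hHne : H.Nonempty) (hHcpt : IsCompact H)
    (hhconv : ConvexOn ℝ H h)
    (hhlsc : LowerSemicontinuous fun x => if x ∈ H then ((h x : ℝ) : EReal) else (⊤ : EReal))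
    (Dh : ℝ) (hDh : Dh = Metric.diam H)
    (f : EuclideanSpace ℝ (Fin n) → ℝ) (f' : EuclideanSpace ℝ (Fin n) → EuclideanSpace ℝ (Fin n))
    (hf : ∀ u ∈ H, HasGradientWithinAt f (f' u) H u)
    (Gf : ℝ) (hGf : IsLUB ((fun u => ‖f' u‖) '' H) Gf)
    (A : EuclideanSpace ℝ (Fin n) →L[ℝ] EuclideanSpace ℝ (Fin l)) (hA : A ≠ 0)
    (σA : ℝ) (hσA : IsLeast {t : ℝ | 0 < t ∧ ∃ w : EuclideanSpace ℝ (Fin n), w ≠ 0 ∧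
      (ContinuousLinearMap.adjoint A) (A w) = (t ^ 2) • w} σA)
    (lam σ : ℝ) (hlam : 0 < lam) (hσ : 0 < σ)
    (z : EuclideanSpace ℝ (Fin n)) (hz : z ∈ H)
    (zm : EuclideanSpace ℝ (Fin n)) (hzm : zm ∈ H)
    (vhat : EuclideanSpace ℝ (Fin n)) (phat : EuclideanSpace ℝ (Fin l))
    (ξ : EuclideanSpace ℝ (Fin n))
    (hξdef : ξ = vhat - f' z - (ContinuousLinearMap.adjoint A) phat)
    (hξ : ∀ z' ∈ H, h z' ≥ h z + ⟪ξ, z' - z⟫)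
    (hvhat : ‖vhat‖ ≤ (1 + σ) * ‖z - zm‖ / lam)
    (hphat : phat ∈ Set.range A) :
    ‖phat‖ ≤ (1 / σA) * (‖ξ‖ + Gf + (1 + σ) * Dh / lam) := by
  obtain ⟨w, rfl⟩ := hphat
  have hσA0 : 0 < σA := hσA.1.1
  have hkey : σA * ‖A w‖ ≤ ‖ContinuousLinearMap.adjoint A (A w)‖ := by
    refine mul_norm_le_norm_adjoint_of_eigenvalue_bound A (fun μ hμ x hx hAx => ?_) w
    have hle : σA ≤ √μ :=
      hσA.2 ⟨Real.sqrt_pos.2 hμ, x, hx, by rw [Real.sq_sqrt hμ.le]; exact hAx⟩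
    exact (Real.le_sqrt hσA0.le hμ.le).1 hle
  have hadj : ContinuousLinearMap.adjoint A (A w) = vhat - f' z - ξ := by
    rw [hξdef]
    abel
  have htri : ‖vhat - f' z - ξ‖ ≤ ‖vhat‖ + ‖f' z‖ + ‖ξ‖ :=
    (norm_sub_le _ _).trans (by gcongr; exact norm_sub_le _ _)
  have hgrad : ‖f' z‖ ≤ Gf := hGf.1 ⟨z, hz, rfl⟩
  have hdiam : ‖z - zm‖ ≤ Dh := by
    rw [hDh, ← dist_eq_norm]
    exact Metric.dist_le_diam_of_mem hHcpt.isBounded hz hzm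
  have hv : ‖vhat‖ ≤ (1 + σ) * Dh / lam := hvhat.trans (by gcongr)
  rw [one_div_mul_eq_div, le_div_iff₀' hσA0]
  rw [hadj] at hkey
  linarith
end

section
/- Let h : ℝⁿ → (−∞, ∞] be proper, lower semicontinuous, convex, K_h-Lipschitz continuous on its compact domain H := dom h of diameter D_h, and let f be differentiable on H with sup_{u∈H} ‖∇f(u)‖ =: G_f < ∞. Let A : ℝⁿ → ℝˡ be a nonzero linear operator with smallest positive singular value σ_A⁺, and suppose z̄ ∈ int H satisfies Az̄ = b; set d̄ := dist_{∂H}(z̄). Let λ > 0, σ > 0, c > 0, θ ∈ (0,1), z ∈ H, z₋ ∈ H, p₋ ∈ ℝˡ, and v̂ ∈ ℝⁿ be such that p̂ := (1−θ)p₋ + c(Az − b) lies in the range of A, ξ := v̂ − ∇f(z) − A*p̂ belongs to ∂h(z), and ‖v̂‖ ≤ (1+σ)‖z − z₋‖/λ. Then c⁻¹‖p̂‖² + d̄ σ_A⁺ ‖p̂‖ ≤ c⁻¹(1−θ)⟨p̂, p₋⟩ + β_λ, where β_λ := (d̄ + D_h)[K_h + G_f + (1+σ)D_h/λ]. -/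
open RealInnerProductSpace
open scoped Classical

/-- A closed ball around a point of `s` whose radius is the distance to the frontier of the
closed set `s` stays in `s`. -/
theorem closedBall_infDist_frontier_subset {E : Type*} [NormedAddCommGroup E] [NormedSpace ℝ E]
    {s : Set E} (hs : IsClosed s) {x : E} (hx : x ∈ s) :
    Metric.closedBall x (Metric.infDist x (frontier s)) ⊆ s := by
  rcases eq_or_ne (Metric.infDist x (frontier s)) 0 with h0 | h0
  · simpa [h0] using hx
  rw [← closure_ball x h0]
  refine closure_minimal (fun y hy => ?_) hs
  by_contra hys
  have hint : ∀ u ∈ Metric.ball x (Metric.infDist x (frontier s)), u ∈ s → u ∈ interior s := by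
    intro u hu hus
    by_contra hui
    have huf : u ∈ frontier s := ⟨subset_closure hus, hui⟩
    have := Metric.infDist_le_dist_of_mem (x := x) huf
    rw [Metric.mem_ball, dist_comm] at hu
    linarith
  have hpos : 0 < Metric.infDist x (frontier s) :=
    lt_of_le_of_ne Metric.infDist_nonneg h0.symm
  have hxb := Metric.mem_ball_self (x := x) hpos
  obtain ⟨u, -, hui, huc⟩ := (convex_ball x (Metric.infDist x (frontier s))).isPreconnected
    (interior s) sᶜ isOpen_interior hs.isOpen_compl
    (fun u hu => (em (u ∈ s)).imp (hint u hu) id) ⟨x, hxb, hint x hxb hx⟩ ⟨y, hy, hys⟩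
  exact huc (interior_subset hui)

/-- On the range of `A`, the adjoint of `A` is bounded below by any lower bound of the
positive singular values of `A`. -/
theorem mul_norm_le_norm_adjoint_apply_of_mem_range {E F : Type*}
    [NormedAddCommGroup E] [InnerProductSpace ℝ E] [FiniteDimensional ℝ E] [CompleteSpace E]
    [NormedAddCommGroup F] [InnerProductSpace ℝ F] [CompleteSpace F]
    (A : E →L[ℝ] F) {s : ℝ} (hs0 : 0 ≤ s)
    (hs : s ∈ lowerBounds {t : ℝ | 0 < t ∧ ∃ w : E, w ≠ 0 ∧
      (ContinuousLinearMap.adjoint A) (A w) = (t ^ 2) • w})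
    {p : F} (hp : p ∈ Set.range A) :
    s * ‖p‖ ≤ ‖ContinuousLinearMap.adjoint A p‖ := by
  obtain ⟨w, rfl⟩ := hp
  set T : E →ₗ[ℝ] E := ((ContinuousLinearMap.adjoint A).comp A).toLinearMap
  have hTapp : ∀ v, T v = ContinuousLinearMap.adjoint A (A v) := fun v => rfl
  have hT : T.IsSymmetric := fun u v => by
    rw [hTapp, hTapp, ContinuousLinearMap.adjoint_inner_left,
      ContinuousLinearMap.adjoint_inner_right]
  set e := hT.eigenvectorBasis rfl
  set μ := hT.eigenvalues rfl
  have heig : ∀ i, T (e i) = μ i • e i := fun i => hT.apply_eigenvectorBasis rfl i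
  have hcoord : ∀ i, ⟪e i, T w⟫ = μ i * ⟪e i, w⟫ := fun i => by
    rw [← hT (e i) w, heig, real_inner_smul_left]
  have hμ0 : ∀ i, 0 ≤ μ i := fun i => by
    have h1 : ⟪e i, T (e i)⟫ = ‖A (e i)‖ ^ 2 := by
      rw [hTapp, ContinuousLinearMap.adjoint_inner_right, real_inner_self_eq_norm_sq]
    rw [heig, real_inner_smul_right, real_inner_self_eq_norm_sq, e.norm_eq_one] at h1
    nlinarith [sq_nonneg ‖A (e i)‖]
  have hμ : ∀ i, s ^ 2 * μ i ≤ μ i ^ 2 := fun i => by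
    rcases (hμ0 i).eq_or_lt with h0 | hpos
    · simp [← h0]
    · have hle : s ≤ √(μ i) := hs ⟨Real.sqrt_pos.2 hpos, e i,
        e.orthonormal.ne_zero i, by rw [Real.sq_sqrt hpos.le, ← heig, hTapp]⟩
      have : s ^ 2 ≤ μ i := (Real.le_sqrt hs0 hpos.le).1 hle
      nlinarith
  have hA : ‖A w‖ ^ 2 = ∑ i, μ i * ⟪e i, w⟫ ^ 2 := by
    rw [← real_inner_self_eq_norm_sq, ← ContinuousLinearMap.adjoint_inner_right, ← hTapp,
      ← e.sum_inner_mul_inner]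
    refine Finset.sum_congr rfl fun i _ => ?_
    rw [hcoord, real_inner_comm]
    ring
  have hTw : ‖T w‖ ^ 2 = ∑ i, μ i ^ 2 * ⟪e i, w⟫ ^ 2 := by
    rw [← real_inner_self_eq_norm_sq, ← e.sum_inner_mul_inner]
    refine Finset.sum_congr rfl fun i _ => ?_
    rw [real_inner_comm, hcoord]
    ring
  rw [← hTapp]
  refine le_of_sq_le_sq ?_ (norm_nonneg _)
  rw [mul_pow, hA, hTw, Finset.mul_sum]
  refine Finset.sum_le_sum fun i _ => ?_
  rw [← mul_assoc]
  exact mul_le_mul_of_nonneg_right (hμ i) (sq_nonneg _)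

/-- A subgradient at `z` of a function that is `K`-Lipschitz on its domain `s` is controlled by
any ball contained in `s`. -/
theorem mul_norm_le_of_subgradient {E : Type*} [NormedAddCommGroup E] [InnerProductSpace ℝ E]
    {h : E → ℝ} {s : Set E} {K : ℝ} (hK : 0 ≤ K)
    (hlip : ∀ x ∈ s, ∀ y ∈ s, |h x - h y| ≤ K * ‖x - y‖)
    {x z ξ : E} {r : ℝ} (hr : 0 ≤ r) (hball : Metric.closedBall x r ⊆ s) (hz : z ∈ s)
    (hξ : ∀ z' ∈ s, h z' ≥ h z + ⟪ξ, z' - z⟫) :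
    r * ‖ξ‖ ≤ K * (r + ‖z - x‖) + ⟪ξ, z - x⟫ := by
  set d : E := (r * ‖ξ‖⁻¹) • ξ with hd
  have hdn : ‖d‖ ≤ r := by
    rw [hd, norm_smul, Real.norm_of_nonneg (by positivity), mul_assoc]
    exact mul_le_of_le_one_right hr (inv_mul_le_one_of_le₀ le_rfl (norm_nonneg _))
  have hdi : ⟪ξ, d⟫ = r * ‖ξ‖ := by
    rw [hd, real_inner_smul_right, real_inner_self_eq_norm_sq]
    rcases eq_or_ne ‖ξ‖ 0 with h0 | h0
    · simp [h0]
    · field_simp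
  have hmem : x + d ∈ s := hball (by simpa using hdn)
  have h1 := hξ _ hmem
  have h2 := (le_abs_self _).trans (hlip _ hmem _ hz)
  have h3 : x + d - z = d - (z - x) := by abel
  rw [h3, inner_sub_right, hdi] at h1
  rw [h3] at h2
  have h4 : ‖d - (z - x)‖ ≤ r + ‖z - x‖ := (norm_sub_le _ _).trans (by gcongr)
  have h5 := mul_le_mul_of_nonneg_left h4 hK
  linarith

/-- Let `h` be proper lsc convex and `K_h`-Lipschitz on its compact effective
domain `H` of diameter `D_h`, `f` differentiable on `H` with `G_f = sup_{u ∈ H} ‖∇f(u)‖`, `A` a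
nonzero linear operator with smallest positive singular value `σ_A⁺`, and `z̄ ∈ int H` with
`Az̄ = b`; set `d̄ = dist_{∂H}(z̄)`.  If `p̂ = (1−θ)p₋ + c(Az − b)` lies in the range of `A`,
`ξ = v̂ − ∇f(z) − A*p̂ ∈ ∂h(z)`, and `‖v̂‖ ≤ (1+σ)‖z − z₋‖/λ`, then
`c⁻¹‖p̂‖² + d̄ σ_A⁺ ‖p̂‖ ≤ c⁻¹(1−θ)⟪p̂, p₋⟫ + β_λ`, where
`β_λ = (d̄ + D_h)[K_h + G_f + (1+σ)D_h/λ]`. -/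
theorem stmt_14 {n l : ℕ} (h : EuclideanSpace ℝ (Fin n) → ℝ)
    (H : Set (EuclideanSpace ℝ (Fin n))) (hHne : H.Nonempty) (hHcpt : IsCompact H)
    (hhconv : ConvexOn ℝ H h)
    (hhlsc : LowerSemicontinuous fun x => if x ∈ H then ((h x : ℝ) : EReal) else (⊤ : EReal))
    (Kh : ℝ) (hKh : 0 ≤ Kh) (hhlip : ∀ x ∈ H, ∀ y ∈ H, |h x - h y| ≤ Kh * ‖x - y‖)
    (Dh : ℝ) (hDh : Dh = Metric.diam H)
    (f : EuclideanSpace ℝ (Fin n) → ℝ) (f' : EuclideanSpace ℝ (Fin n) → EuclideanSpace ℝ (Fin n))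
    (hf : ∀ u ∈ H, HasGradientWithinAt f (f' u) H u)
    (Gf : ℝ) (hGf : IsLUB ((fun u => ‖f' u‖) '' H) Gf)
    (A : EuclideanSpace ℝ (Fin n) →L[ℝ] EuclideanSpace ℝ (Fin l)) (hA : A ≠ 0)
    (σA : ℝ) (hσA : IsLeast {t : ℝ | 0 < t ∧ ∃ w : EuclideanSpace ℝ (Fin n), w ≠ 0 ∧
      (ContinuousLinearMap.adjoint A) (A w) = (t ^ 2) • w} σA)
    (b : EuclideanSpace ℝ (Fin l))
    (zbar : EuclideanSpace ℝ (Fin n)) (hzbar : zbar ∈ interior H) (hzbarb : A zbar = b)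
    (dbar : ℝ) (hdbar : dbar = Metric.infDist zbar (frontier H))
    (lam σ c θ : ℝ) (hlam : 0 < lam) (hσ : 0 < σ) (hc : 0 < c) (hθ : θ ∈ Set.Ioo (0 : ℝ) 1)
    (z : EuclideanSpace ℝ (Fin n)) (hz : z ∈ H)
    (zm : EuclideanSpace ℝ (Fin n)) (hzm : zm ∈ H)
    (pm : EuclideanSpace ℝ (Fin l)) (vhat : EuclideanSpace ℝ (Fin n))
    (phat : EuclideanSpace ℝ (Fin l)) (hphatdef : phat = (1 - θ) • pm + c • (A z - b))
    (hphat : phat ∈ Set.range A)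
    (ξ : EuclideanSpace ℝ (Fin n))
    (hξdef : ξ = vhat - f' z - (ContinuousLinearMap.adjoint A) phat)
    (hξ : ∀ z' ∈ H, h z' ≥ h z + ⟪ξ, z' - z⟫)
    (hvhat : ‖vhat‖ ≤ (1 + σ) * ‖z - zm‖ / lam) :
    c⁻¹ * ‖phat‖ ^ 2 + dbar * σA * ‖phat‖ ≤
      c⁻¹ * (1 - θ) * ⟪phat, pm⟫ + (dbar + Dh) * (Kh + Gf + (1 + σ) * Dh / lam) := by
  have hzb : zbar ∈ H := interior_subset hzbar
  have hd0 : 0 ≤ dbar := hdbar ▸ Metric.infDist_nonneg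
  have hdiam : ∀ x ∈ H, ‖z - x‖ ≤ Dh := fun x hx => by
    rw [hDh, ← dist_eq_norm]
    exact Metric.dist_le_diam_of_mem hHcpt.isBounded hz hx
  have hsub := mul_norm_le_of_subgradient hKh hhlip hd0
    (hdbar ▸ closedBall_infDist_frontier_subset hHcpt.isClosed hzb) hz hξ
  have hAp := mul_norm_le_norm_adjoint_apply_of_mem_range A hσA.1.1.le hσA.2 hphat
  set a := ContinuousLinearMap.adjoint A phat with ha
  set g := vhat - f' z with hg
  have hgn : ‖g‖ ≤ Gf + (1 + σ) * Dh / lam := by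
    have h1 : ‖f' z‖ ≤ Gf := hGf.1 ⟨z, hz, rfl⟩
    have h2 : (1 + σ) * ‖z - zm‖ / lam ≤ (1 + σ) * Dh / lam := by
      gcongr
      exact hdiam zm hzm
    have h3 := norm_sub_le vhat (f' z)
    linarith
  have haξ : ‖a‖ ≤ ‖g‖ + ‖ξ‖ := by
    have h1 : a = g - ξ := by rw [hξdef]; abel
    rw [h1]
    exact norm_sub_le _ _
  have hfeas : ⟪a, z - zbar⟫ = c⁻¹ * ‖phat‖ ^ 2 - c⁻¹ * (1 - θ) * ⟪phat, pm⟫ := by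
    have h1 : ⟪phat, phat⟫ = (1 - θ) * ⟪phat, pm⟫ + c * ⟪phat, A z - b⟫ := by
      conv_lhs => rw [hphatdef, inner_add_right, real_inner_smul_right, real_inner_smul_right,
        ← hphatdef]
    rw [ha, ContinuousLinearMap.adjoint_inner_left, map_sub, hzbarb,
      ← real_inner_self_eq_norm_sq, h1]
    field_simp
    ring
  have hinner : ⟪ξ, z - zbar⟫ ≤ ‖g‖ * ‖z - zbar‖ - ⟪a, z - zbar⟫ := by
    rw [hξdef, inner_sub_left]
    linarith [real_inner_le_norm g (z - zbar)]
  have hzD := hdiam zbar hzb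
  have hbound : (dbar + ‖z - zbar‖) * (Kh + ‖g‖) ≤
      (dbar + Dh) * (Kh + (Gf + (1 + σ) * Dh / lam)) := by
    have := (norm_nonneg _).trans hzD
    gcongr
  have h1 := mul_le_mul_of_nonneg_left (hAp.trans haξ) hd0
  linarith
end

section
/- Let h : ℝⁿ → (−∞, ∞] be proper, lower semicontinuous, convex, with compact domain H := dom h of diameter D_h, let f be differentiable on ℝⁿ with −(m/2)‖u−z‖² ≤ f(u) − f(z) − ⟨∇f(z), u−z⟩ for all u, z and some m > 0, and suppose φ_* := inf_{u∈ℝⁿ} (f+h)(u) > −∞ and the feasible set F := {z ∈ H : Az = b} is nonempty with φ* := inf_{u∈F} (f+h)(u). Let λ = 1/(2m), σ ∈ (0, 1/2], c ≥ c₁ > 0, (χ, θ) ∈ (0,1)² with 2(1−θ)(2−θ)χ ≤ θ², and suppose z₋ ∈ H, p₋₋, p₋ ∈ ℝˡ with ‖p₋₋‖ ≤ B_p, ‖p₋‖ ≤ B_p, and z, v, p satisfy: v ∈ ∂(λ L_c^θ(·; p₋) + (1/2)‖· − z₋‖²)(z) with ‖v‖ ≤ σ‖z − z₋‖, p = (1−θ)p₋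 + χ c (Az − b), and ‖p‖ ≤ B_p. Then the potential Ψ := L_c^θ(z; p) − (a_θ/(2χc))‖p‖² + (α_{χ,θ}/(4χc))‖p − p₋‖² satisfies φ_* − ((1−θ)/(2χc₁)) B_p² ≤ Ψ ≤ φ* + D_h²/λ + ((1 + 2 b_θ)/(2χ² c₁)) B_p². -/
open RealInnerProductSpace
open scoped Classical

/-- The multiplier terms of the potential are bounded below by `-(t / 2) B²` when `0 ≤ α`. -/
lemma multiplier_terms_lower {P Q I t α B : ℝ} (ht0 : 0 ≤ t) (ht1 : t ≤ 1) (hα : 0 ≤ α)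
    (hP : 0 ≤ P) (hQ : Q ≤ B ^ 2) (hW : 0 ≤ P - 2 * I + Q) :
    -(t / 2) * B ^ 2 ≤
      t * (P - t * I) - (1 - t) * t / 2 * P + α / 4 * (P - 2 * I + Q) := by
  have h1 : 0 ≤ α * (P - 2 * I + Q) := mul_nonneg hα hW
  have h2 : 0 ≤ t ^ 2 * (P - 2 * I + Q) := mul_nonneg (sq_nonneg t) hW
  have h3 : 0 ≤ t * P := mul_nonneg ht0 hP
  have h4 : t ^ 2 * Q ≤ t ^ 2 * B ^ 2 := mul_le_mul_of_nonneg_left hQ (sq_nonneg t)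
  have h5 : t ^ 2 * B ^ 2 ≤ t * B ^ 2 :=
    mul_le_mul_of_nonneg_right (by nlinarith) (sq_nonneg B)
  nlinarith

/-- The change of the potential against the Lagrangian at the previous multiplier is bounded
by a multiple of `B²`. -/
lemma multiplier_terms_upper {P Q I t χ B : ℝ} (ht0 : 0 ≤ t) (ht1 : t ≤ 1) (hχ0 : 0 < χ)
    (hχ1 : χ ≤ 1) (hα : 0 ≤ (1 - 2 * χ * ((1 + t) * t) - t ^ 2) / (2 * χ))
    (hQ : 0 ≤ Q) (hW : P - 2 * I + Q ≤ 4 * B ^ 2) :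
    t * ((P - t * I) - (I - t * Q)) - (1 - t) * t / 2 * P
        + (1 - 2 * χ * ((1 + t) * t) - t ^ 2) / (2 * χ) / 4 * (P - 2 * I + Q) ≤
      (1 + 2 * ((1 + t) * t)) / (2 * χ) * B ^ 2 := by
  set α := (1 - 2 * χ * ((1 + t) * t) - t ^ 2) / (2 * χ) with hαdef
  have hb : 0 ≤ (1 + t) * t := by positivity
  have h1 : ((1 + t) * t / 2 + α / 4) * (P - 2 * I + Q) ≤
      ((1 + t) * t / 2 + α / 4) * (4 * B ^ 2) :=
    mul_le_mul_of_nonneg_left hW (by positivity)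
  have h2 : 2 * ((1 + t) * t) + α ≤ (1 + 2 * ((1 + t) * t)) / (2 * χ) := by
    have h3 : 2 * ((1 + t) * t) + α = (1 + 2 * χ * ((1 + t) * t) - t ^ 2) / (2 * χ) := by
      rw [hαdef]; field_simp; ring
    rw [h3]
    gcongr ?_ / _
    nlinarith [mul_nonneg hb (sub_nonneg.2 hχ1), sq_nonneg t]
  have h4 := mul_le_mul_of_nonneg_right h2 (sq_nonneg B)
  have h5 : 0 ≤ (1 - t) * t * Q := mul_nonneg (mul_nonneg (by linarith) ht0) hQ
  nlinarith

/-- An inexact proximal step controls the objective at `z` by the one at `z'`, up to the squared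
diameter over the step size. -/
lemma inexact_prox_le {E : Type*} [NormedAddCommGroup E] [InnerProductSpace ℝ E]
    {z z' zm v : E} {a a' lam σ D : ℝ} (hlam : 0 < lam) (hσ : σ ≤ 1 / 2)
    (hsub : lam * a' + 1 / 2 * ‖z' - zm‖ ^ 2 ≥ lam * a + 1 / 2 * ‖z - zm‖ ^ 2 + ⟪v, z' - z⟫)
    (hv : ‖v‖ ≤ σ * ‖z - zm‖) (h1 : ‖z' - zm‖ ≤ D) (h2 : ‖z' - z‖ ≤ D) :
    a ≤ a' + D ^ 2 / lam := by
  have hv' : ‖v‖ ≤ 1 / 2 * ‖z - zm‖ :=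
    hv.trans (mul_le_mul_of_nonneg_right hσ (norm_nonneg _))
  have h3 := neg_le_of_abs_le (abs_real_inner_le_norm v (z' - z))
  have h4 : ‖v‖ * ‖z' - z‖ ≤ (1 / 2 * ‖z - zm‖) * D :=
    mul_le_mul hv' h2 (norm_nonneg _) (by positivity)
  have h5 : ‖z' - zm‖ ^ 2 ≤ D ^ 2 := pow_le_pow_left₀ (norm_nonneg _) h1 2
  have h6 : lam * a ≤ lam * a' + D ^ 2 := by
    nlinarith [sq_nonneg (‖z - zm‖ - D / 2), sq_nonneg D]
  have h7 : lam * (a' + D ^ 2 / lam) = lam * a' + D ^ 2 := by field_simp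
  exact le_of_mul_le_mul_left (h7 ▸ h6) hlam

/-- Let `h` be proper lsc convex with compact effective domain `H` of diameter
`D_h`, `f` differentiable with `−(m/2)‖u−z‖² ≤ f(u) − f(z) − ⟪∇f(z), u−z⟫`, and suppose
`φ_* = inf_{ℝⁿ}(f+h) > −∞` and the feasible set `F = {z ∈ H : Az = b}` is nonempty with
`φ* = inf_F (f+h)`.  With `λ = 1/(2m)`, `σ ∈ (0,1/2]`, `c ≥ c₁ > 0`, `(χ,θ) ∈ (0,1)²` with
`2(1−θ)(2−θ)χ ≤ θ²`, bounded multipliers and an inexact prox step plus a multiplier update, the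
potential `Ψ` satisfies
`φ_* − ((1−θ)/(2χc₁))B_p² ≤ Ψ ≤ φ* + D_h²/λ + ((1+2b_θ)/(2χ²c₁))B_p²`. -/
theorem stmt_16 {n l : ℕ} (h : EuclideanSpace ℝ (Fin n) → ℝ)
    (H : Set (EuclideanSpace ℝ (Fin n))) (hHne : H.Nonempty) (hHcpt : IsCompact H)
    (hhconv : ConvexOn ℝ H h)
    (hhlsc : LowerSemicontinuous fun x => if x ∈ H then ((h x : ℝ) : EReal) else (⊤ : EReal))
    (Dh : ℝ) (hDh : Dh = Metric.diam H)
    (f : EuclideanSpace ℝ (Fin n) → ℝ) (f' : EuclideanSpace ℝ (Fin n) → EuclideanSpace ℝ (Fin n))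
    (hf : ∀ x, HasGradientAt f (f' x) x)
    (m : ℝ) (hm : 0 < m)
    (hwc : ∀ u z, -(m / 2) * ‖u - z‖ ^ 2 ≤ f u - f z - ⟪f' z, u - z⟫)
    (A : EuclideanSpace ℝ (Fin n) →L[ℝ] EuclideanSpace ℝ (Fin l))
    (b : EuclideanSpace ℝ (Fin l))
    (φlow : ℝ) (hφlow : IsGLB ((fun u => f u + h u) '' H) φlow)
    (hfeas : {u ∈ H | A u = b}.Nonempty)
    (φup : ℝ) (hφup : IsGLB ((fun u => f u + h u) '' {u ∈ H | A u = b}) φup)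
    (lam σ c c₁ χ θ : ℝ) (hlam : lam = 1 / (2 * m)) (hσ : σ ∈ Set.Ioc (0 : ℝ) (1 / 2))
    (hc₁ : 0 < c₁) (hc : c₁ ≤ c)
    (hχ : χ ∈ Set.Ioo (0 : ℝ) 1) (hθ : θ ∈ Set.Ioo (0 : ℝ) 1)
    (hcond : 2 * (1 - θ) * (2 - θ) * χ ≤ θ ^ 2)
    (Bp : ℝ) (zm : EuclideanSpace ℝ (Fin n)) (hzm : zm ∈ H)
    (pmm pm : EuclideanSpace ℝ (Fin l)) (hpmm : ‖pmm‖ ≤ Bp) (hpm : ‖pm‖ ≤ Bp)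
    (z : EuclideanSpace ℝ (Fin n)) (hzH : z ∈ H) (v : EuclideanSpace ℝ (Fin n))
    (p : EuclideanSpace ℝ (Fin l))
    (hsub : ∀ z' ∈ H,
      lam * augLag f h A b c θ z' pm + 1 / 2 * ‖z' - zm‖ ^ 2 ≥
        lam * augLag f h A b c θ z pm + 1 / 2 * ‖z - zm‖ ^ 2 + ⟪v, z' - z⟫)
    (hv : ‖v‖ ≤ σ * ‖z - zm‖)
    (hp : p = (1 - θ) • pm + (χ * c) • (A z - b)) (hpB : ‖p‖ ≤ Bp) :
    φlow - (1 - θ) / (2 * χ * c₁) * Bp ^ 2 ≤ potential f h A b c χ θ z p pm ∧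
      potential f h A b c χ θ z p pm ≤
        φup + Dh ^ 2 / lam + (1 + 2 * ((2 - θ) * (1 - θ))) / (2 * χ ^ 2 * c₁) * Bp ^ 2 := by
  obtain ⟨hχ0, hχ1⟩ := hχ
  obtain ⟨hθ0, hθ1⟩ := hθ
  have hc0 : 0 < c := hc₁.trans_le hc
  have hk : 0 < χ * c := mul_pos hχ0 hc0
  have hlam0 : 0 < lam := by rw [hlam]; positivity
  obtain ⟨t, rfl⟩ : ∃ t, θ = 1 - t := ⟨1 - θ, by ring⟩
  have ht0 : 0 ≤ t := by linarith
  have ht1 : t ≤ 1 := by linarith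
  have hα : 0 ≤ (1 - 2 * χ * ((1 + t) * t) - t ^ 2) / (2 * χ) :=
    div_nonneg (by nlinarith) (by positivity)
  have hr : A z - b = (χ * c)⁻¹ • (p - t • pm) := by
    rw [hp, sub_sub_cancel, add_sub_cancel_left, smul_smul, inv_mul_cancel₀ hk.ne', one_smul]
  have hpr : ⟪p, A z - b⟫ = (‖p‖ ^ 2 - t * ⟪p, pm⟫) / (χ * c) := by
    rw [hr, inner_smul_right, inner_sub_right, inner_smul_right, real_inner_self_eq_norm_sq,
      div_eq_inv_mul]
  have hpmr : ⟪pm, A z - b⟫ = (⟪p, pm⟫ - t * ‖pm‖ ^ 2) / (χ * c) := by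
    rw [hr, inner_smul_right, inner_sub_right, inner_smul_right, real_inner_self_eq_norm_sq,
      div_eq_inv_mul, real_inner_comm]
  have hW : ‖p - pm‖ ^ 2 = ‖p‖ ^ 2 - 2 * ⟪p, pm⟫ + ‖pm‖ ^ 2 := norm_sub_sq_real p pm
  have hΨ : potential f h A b c χ (1 - t) z p pm = f z + h z + c / 2 * ‖A z - b‖ ^ 2 +
      (t * (‖p‖ ^ 2 - t * ⟪p, pm⟫) - (1 - t) * t / 2 * ‖p‖ ^ 2 +
        (1 - 2 * χ * ((1 + t) * t) - t ^ 2) / (2 * χ) / 4 *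
          (‖p‖ ^ 2 - 2 * ⟪p, pm⟫ + ‖pm‖ ^ 2)) / (χ * c) := by
    rw [potential, augLag, hpr, hW]
    field_simp
    ring
  have hΨ' : potential f h A b c χ (1 - t) z p pm = augLag f h A b c (1 - t) z pm +
      (t * ((‖p‖ ^ 2 - t * ⟪p, pm⟫) - (⟪p, pm⟫ - t * ‖pm‖ ^ 2)) - (1 - t) * t / 2 * ‖p‖ ^ 2 +
        (1 - 2 * χ * ((1 + t) * t) - t ^ 2) / (2 * χ) / 4 *
          (‖p‖ ^ 2 - 2 * ⟪p, pm⟫ + ‖pm‖ ^ 2)) / (χ * c) := by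
    rw [hΨ, augLag, hpmr]
    field_simp
    ring
  constructor
  · have hlow := multiplier_terms_lower (I := ⟪p, pm⟫) ht0 ht1 hα (sq_nonneg ‖p‖)
      (pow_le_pow_left₀ (norm_nonneg _) hpm 2) (hW ▸ sq_nonneg _)
    have hlow' := div_le_div_of_nonneg_right hlow hk.le
    have hg : φlow ≤ f z + h z := hφlow.1 ⟨z, hzH, rfl⟩
    have hscale : t * Bp ^ 2 / (2 * χ * c) ≤ t * Bp ^ 2 / (2 * χ * c₁) := by gcongr
    have e1 : -(t / 2) * Bp ^ 2 / (χ * c) = -(t * Bp ^ 2 / (2 * χ * c)) := by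
      field_simp
    have e2 : (1 - (1 - t)) / (2 * χ * c₁) * Bp ^ 2 = t * Bp ^ 2 / (2 * χ * c₁) := by
      rw [sub_sub_cancel]; ring
    have hquad : 0 ≤ c / 2 * ‖A z - b‖ ^ 2 := by positivity
    rw [hΨ, e2]
    linarith
  · have hnorm : ‖p - pm‖ ≤ 2 * Bp := (norm_sub_le p pm).trans (by linarith)
    have hWB : ‖p‖ ^ 2 - 2 * ⟪p, pm⟫ + ‖pm‖ ^ 2 ≤ 4 * Bp ^ 2 := by
      rw [← hW]
      exact (pow_le_pow_left₀ (norm_nonneg _) hnorm 2).trans_eq (by ring)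
    have hup := multiplier_terms_upper ht0 ht1 hχ0 hχ1.le hα (sq_nonneg ‖pm‖) hWB
    have hup' := div_le_div_of_nonneg_right hup hk.le
    have hscale : (1 + 2 * ((1 + t) * t)) * Bp ^ 2 / (2 * χ ^ 2 * c) ≤
        (1 + 2 * ((1 + t) * t)) * Bp ^ 2 / (2 * χ ^ 2 * c₁) := by gcongr
    have e1 : (1 + 2 * ((1 + t) * t)) / (2 * χ) * Bp ^ 2 / (χ * c) =
        (1 + 2 * ((1 + t) * t)) * Bp ^ 2 / (2 * χ ^ 2 * c) := by
      field_simp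
    have e2 : (1 + 2 * ((2 - (1 - t)) * (1 - (1 - t)))) / (2 * χ ^ 2 * c₁) * Bp ^ 2 =
        (1 + 2 * ((1 + t) * t)) * Bp ^ 2 / (2 * χ ^ 2 * c₁) := by
      ring
    have hinf : augLag f h A b c (1 - t) z pm - Dh ^ 2 / lam ≤ φup := by
      refine hφup.2 ?_
      rintro _ ⟨z', ⟨hz'H, hz'b⟩, rfl⟩
      have hdist : ∀ w ∈ H, ‖z' - w‖ ≤ Dh := fun w hw => by
        rw [← dist_eq_norm, hDh]
        exact Metric.dist_le_diam_of_mem hHcpt.isBounded hz'H hw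
      have hprox := inexact_prox_le hlam0 hσ.2 (hsub z' hz'H) hv (hdist zm hzm) (hdist z hzH)
      have hL : augLag f h A b c (1 - t) z' pm = f z' + h z' := by
        simp [augLag, hz'b]
      rw [hL] at hprox
      simp only
      linarith
    rw [hΨ', e2]
    linarith
end

section
/- Under the setting of the telescoping estimate — namely h proper lsc convex with compact domain H = dom h of diameter D_h, f differentiable on ℝⁿ with −(m/2)‖u−z‖² ≤ f(u)−f(z)−⟨∇f(z),u−z⟩ for all u,z, λ = 1/(2m), σ ∈ (0,1/2], c ≥ c₁ > 0, (χ,θ) ∈ (0,1)² with 2(1−θ)(2−θ)χ ≤ θ², φ_* := inf_{ℝⁿ}(f+h) > −∞, F := {z∈H : Az=b} ≠ ∅ with φ* := inf_F (f+h), integers j < k, and sequences z_j,…,z_k ∈ H, p_{j−1},…,p_k ∈ ℝˡ with ‖pᵢ‖ ≤ B_p for all i, pᵢ = (1−θ)pᵢ₋₁ + χc(Azᵢ − b) for i = j,…,k, and vᵢ ∈ ∂(λ L_c^θ(·; pᵢ₋₁) + (1/2)‖· − zᵢ₋₁‖²)(zᵢ) with ‖vᵢ‖ ≤ σ‖zᵢ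 − zᵢ₋₁‖ for i = j+1,…,k — there exists an index i ∈ {j+1, …, k} such that λ‖v̂ᵢ‖² ≤ 32 B_Ψ / (k − j), where v̂ᵢ := (vᵢ + zᵢ₋₁ − zᵢ)/λ and B_Ψ := φ* − φ_* + D_h²/λ + ((2 − θ + 2(2−θ)(1−θ))/(2χ²c₁)) B_p². -/
open RealInnerProductSpace
open scoped Classical

lemma multiplier_coeff_le {θ χ c : ℝ} (hθ : θ ∈ Set.Ioo (0 : ℝ) 1) (hχ : 0 < χ) (hχ1 : χ ≤ 1)
    (hc : 0 < c) (B : ℝ) :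
    (1 - θ) * θ / (2 * χ * c) * B ^ 2 + (1 - θ) ^ 2 / (2 * c) * B ^ 2 ≤
      (1 - θ) / 2 * (B ^ 2 / (χ ^ 2 * c)) := by
  have hα : 0 ≤ 1 - θ := sub_nonneg.2 hθ.2.le
  have e : (1 - θ) * θ / (2 * χ * c) * B ^ 2 + (1 - θ) ^ 2 / (2 * c) * B ^ 2 =
      (1 - θ) * (θ * χ + (1 - θ) * χ ^ 2) / 2 * (B ^ 2 / (χ ^ 2 * c)) := by
    field_simp
  have h1 : θ * χ ≤ θ := mul_le_of_le_one_right hθ.1.le hχ1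
  have h2 : (1 - θ) * χ ^ 2 ≤ 1 - θ := mul_le_of_le_one_right hα (pow_le_one₀ hχ.le hχ1)
  rw [e]
  gcongr
  exact mul_le_of_le_one_right hα (by linarith)

lemma multiplier_bound_coeff_le {θ χ c c₁ : ℝ} (hθ : θ ∈ Set.Ioo (0 : ℝ) 1) (hχ : 0 < χ)
    (hc₁ : 0 < c₁) (hc : c₁ ≤ c) (B : ℝ) :
    9 * ((1 + θ) / 2 * (B ^ 2 / (χ ^ 2 * c))) ≤
      32 * ((2 - θ + 2 * (2 - θ) * (1 - θ)) / (2 * χ ^ 2 * c₁) * B ^ 2) := by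
  have hcpos : 0 < c := hc₁.trans_le hc
  obtain ⟨hθ0, hθ1⟩ := hθ
  have e : 32 * ((2 - θ + 2 * (2 - θ) * (1 - θ)) / (2 * χ ^ 2 * c₁) * B ^ 2) =
      16 * ((2 - θ) * (3 - 2 * θ)) * (B ^ 2 / (χ ^ 2 * c₁)) := by
    field_simp; ring
  rw [e, ← mul_assoc]
  have h1 : 9 * ((1 + θ) / 2) ≤ 16 * ((2 - θ) * (3 - 2 * θ)) := by nlinarith
  have h2 : B ^ 2 / (χ ^ 2 * c) ≤ B ^ 2 / (χ ^ 2 * c₁) := by gcongr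
  exact mul_le_mul h1 h2 (by positivity) (by nlinarith)

section InnerProduct

variable {E : Type*} [NormedAddCommGroup E] [InnerProductSpace ℝ E]

lemma norm_add_smul_sq_eq (x d : E) (t : ℝ) :
    ‖x + t • d‖ ^ 2 = (1 - t) * ‖x‖ ^ 2 + t * ‖x + d‖ ^ 2 - t * (1 - t) * ‖d‖ ^ 2 := by
  rw [norm_add_sq_real, norm_add_sq_real, inner_smul_right, norm_smul, mul_pow, Real.norm_eq_abs,
    sq_abs]
  ring

lemma norm_smul_add_smul_sq_le {θ : ℝ} (hθ : θ ∈ Set.Ioo (0 : ℝ) 1) (r : ℝ) (x y : E) :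
    ‖(1 - θ) • x + r • y‖ ^ 2 ≤ (1 - θ) * ‖x‖ ^ 2 + r ^ 2 / θ * ‖y‖ ^ 2 := by
  have hpos := hθ.1
  have h1 : 0 < 1 - θ := sub_pos.2 hθ.2
  have key := norm_add_smul_sq_eq x ((r / θ) • y - x) θ
  have e : x + θ • ((r / θ) • y - x) = (1 - θ) • x + r • y := by
    rw [smul_sub, smul_smul, mul_div_cancel₀ _ hpos.ne', sub_smul, one_smul]
    abel
  rw [e, add_sub_cancel, norm_smul, mul_pow, Real.norm_eq_abs, sq_abs] at key
  rw [key]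
  have e2 : θ * ((r / θ) ^ 2 * ‖y‖ ^ 2) = r ^ 2 / θ * ‖y‖ ^ 2 := by
    field_simp
  have : 0 ≤ θ * (1 - θ) * ‖(r / θ) • y - x‖ ^ 2 := by positivity
  linarith

lemma dampened_norm_sq_le {θ χ c : ℝ} (hθ : θ ∈ Set.Ioo (0 : ℝ) 1) (hχ : 0 < χ) (hc : 0 < c)
    (hcond : 2 * (1 - θ) * (2 - θ) * χ ≤ θ ^ 2) (x y : E) :
    (1 - θ) * (2 - θ) / (2 * χ * c) * ‖(1 - θ) • x + (χ * c) • y‖ ^ 2 ≤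
      (1 - θ) ^ 2 * (2 - θ) / (2 * χ * c * θ) *
          (‖x‖ ^ 2 - ‖(1 - θ) • x + (χ * c) • y‖ ^ 2) + c / 2 * ‖y‖ ^ 2 := by
  have hle := norm_smul_add_smul_sq_le hθ (χ * c) x y
  obtain ⟨hθ0, hθ1⟩ := hθ
  have hα : 0 < 1 - θ := sub_pos.2 hθ1
  set w := ‖(1 - θ) • x + (χ * c) • y‖ ^ 2
  have hco : 0 ≤ (1 - θ) * (2 - θ) / (2 * χ * c * θ) := by
    have : 0 < 2 - θ := by linarith
    positivity
  have h1 := mul_le_mul_of_nonneg_left hle hco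
  have e1 : (1 - θ) * (2 - θ) / (2 * χ * c * θ) * w =
      (1 - θ) * (2 - θ) / (2 * χ * c) * w +
        (1 - θ) ^ 2 * (2 - θ) / (2 * χ * c * θ) * w := by
    field_simp; ring
  have e2 : (1 - θ) * (2 - θ) / (2 * χ * c * θ) *
      ((1 - θ) * ‖x‖ ^ 2 + (χ * c) ^ 2 / θ * ‖y‖ ^ 2) =
      (1 - θ) ^ 2 * (2 - θ) / (2 * χ * c * θ) * ‖x‖ ^ 2 +
        2 * (1 - θ) * (2 - θ) * χ / θ ^ 2 * (c / 4 * ‖y‖ ^ 2) := by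
    field_simp; ring
  have h2 : 2 * (1 - θ) * (2 - θ) * χ / θ ^ 2 ≤ 1 := (div_le_one (by positivity)).2 hcond
  have h3 : 0 ≤ c / 4 * ‖y‖ ^ 2 := by positivity
  have h4 := mul_le_mul_of_nonneg_right h2 h3
  rw [e1, e2] at h1
  linarith

lemma le_convexCombo_add_of_weaklyConvex {f : E → ℝ} {f' : E → E} {m : ℝ}
    (hwc : ∀ u z, -(m / 2) * ‖u - z‖ ^ 2 ≤ f u - f z - ⟪f' z, u - z⟫) (x y : E)
    {t : ℝ} (ht : t ∈ Set.Icc (0 : ℝ) 1) :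
    f (x + t • (y - x)) ≤
      (1 - t) * f x + t * f y + m / 2 * (t * (1 - t)) * ‖y - x‖ ^ 2 := by
  have hx := hwc x (x + t • (y - x))
  have hy := hwc y (x + t • (y - x))
  have ex : x - (x + t • (y - x)) = (-t) • (y - x) := by module
  have ey : y - (x + t • (y - x)) = (1 - t) • (y - x) := by module
  rw [ex, inner_smul_right, norm_smul, mul_pow, Real.norm_eq_abs, sq_abs] at hx
  rw [ey, inner_smul_right, norm_smul, mul_pow, Real.norm_eq_abs, sq_abs] at hy
  have h1 := mul_le_mul_of_nonneg_left hx (sub_nonneg.2 ht.2)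
  have h2 := mul_le_mul_of_nonneg_left hy ht.1
  linarith

lemma le_of_forall_one_sub_mul_le_s17 {X Q : ℝ}
    (h : ∀ t ∈ Set.Ioo (0 : ℝ) 1, (1 - t) * Q ≤ X) : Q ≤ X := by
  have hc : Filter.Tendsto (fun t : ℝ => (1 - t) * Q) (nhdsWithin 0 (Set.Ioi 0)) (nhds Q) := by
    have : Continuous fun t : ℝ => (1 - t) * Q := by fun_prop
    simpa using (this.tendsto 0).mono_left nhdsWithin_le_nhds
  exact le_of_tendsto hc
    (Filter.eventually_of_mem (Ioo_mem_nhdsGT one_pos) h)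

end InnerProduct

/-- The prox-augmented Lagrangian grows quadratically around a point with a given subgradient. -/
lemma augLag_prox_growth {n l : ℕ} {h f : EuclideanSpace ℝ (Fin n) → ℝ}
    {H : Set (EuclideanSpace ℝ (Fin n))} (hhconv : ConvexOn ℝ H h)
    {f' : EuclideanSpace ℝ (Fin n) → EuclideanSpace ℝ (Fin n)} {m : ℝ} (hm : 0 < m)
    (hwc : ∀ u z, -(m / 2) * ‖u - z‖ ^ 2 ≤ f u - f z - ⟪f' z, u - z⟫)
    (A : EuclideanSpace ℝ (Fin n) →L[ℝ] EuclideanSpace ℝ (Fin l))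
    (b : EuclideanSpace ℝ (Fin l)) {lam : ℝ} (c θ : ℝ) (hlam : lam = 1 / (2 * m))
    {x z₀ v : EuclideanSpace ℝ (Fin n)} {p : EuclideanSpace ℝ (Fin l)} (hx : x ∈ H)
    (hsub : ∀ y ∈ H, lam * augLag f h A b c θ y p + 1 / 2 * ‖y - z₀‖ ^ 2 ≥
      lam * augLag f h A b c θ x p + 1 / 2 * ‖x - z₀‖ ^ 2 + ⟪v, y - x⟫)
    {y : EuclideanSpace ℝ (Fin n)} (hy : y ∈ H) :
    lam * augLag f h A b c θ x p + 1 / 2 * ‖x - z₀‖ ^ 2 + ⟪v, y - x⟫ +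
        (1 / 4 * ‖y - x‖ ^ 2 + lam * c / 2 * ‖A (y - x)‖ ^ 2) ≤
      lam * augLag f h A b c θ y p + 1 / 2 * ‖y - z₀‖ ^ 2 := by
  have hl : 0 < lam := by rw [hlam]; positivity
  have hlm : lam * m = 1 / 2 := by rw [hlam]; field_simp
  rw [← le_sub_iff_add_le']
  refine le_of_forall_one_sub_mul_le_s17 fun t ht => ?_
  have hcomb : x + t • (y - x) = (1 - t) • x + t • y := by module
  have hw : x + t • (y - x) ∈ H := by
    rw [hcomb]
    exact hhconv.1 hx hy (sub_nonneg.2 ht.2.le) ht.1.le (by ring)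
  have hs := hsub _ hw
  have hfw := mul_le_mul_of_nonneg_left
    (le_convexCombo_add_of_weaklyConvex hwc x y ⟨ht.1.le, ht.2.le⟩) hl.le
  have hhw := mul_le_mul_of_nonneg_left
    (hhconv.2 hx hy (sub_nonneg.2 ht.2.le) ht.1.le (by ring)) hl.le
  rw [← hcomb] at hhw
  simp only [smul_eq_mul] at hhw
  have hq := norm_add_smul_sq_eq (x - z₀) (y - x) t
  have hqA := norm_add_smul_sq_eq (A x - b) (A (y - x)) t
  have e1 : x + t • (y - x) - z₀ = x - z₀ + t • (y - x) := by abel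
  have e2 : x - z₀ + (y - x) = y - z₀ := by abel
  have e3 : A (x + t • (y - x)) - b = A x - b + t • A (y - x) := by
    rw [map_add, map_smul]; abel
  have e4 : A x - b + A (y - x) = A y - b := by rw [map_sub]; abel
  have e5 : ⟪p, A x - b + t • A (y - x)⟫ =
      (1 - t) * ⟪p, A x - b⟫ + t * ⟪p, A y - b⟫ := by
    rw [← e4, inner_add_right, inner_add_right, inner_smul_right]; ring
  rw [e2] at hq
  rw [e4] at hqA
  have e6 : x + t • (y - x) - x = t • (y - x) := by abel
  unfold augLag at hs ⊢
  rw [e1, e3, e5, e6, hq, hqA, inner_smul_right] at hs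
  have hlm2 : lam * (m / 2 * (t * (1 - t)) * ‖y - x‖ ^ 2) =
      1 / 4 * (t * (1 - t)) * ‖y - x‖ ^ 2 := by
    linear_combination (t * (1 - t)) * ‖y - x‖ ^ 2 / 2 * hlm
  refine le_of_mul_le_mul_left ?_ ht.1
  linarith

/-- Change of the augmented Lagrangian under the dampened multiplier update. -/
lemma augLag_multiplier_update {n l : ℕ} (f h : EuclideanSpace ℝ (Fin n) → ℝ)
    (A : EuclideanSpace ℝ (Fin n) →L[ℝ] EuclideanSpace ℝ (Fin l))
    (b : EuclideanSpace ℝ (Fin l)) {c χ : ℝ} (θ : ℝ) (hc : 0 < c) (hχ : 0 < χ)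
    {z : EuclideanSpace ℝ (Fin n)} {p q : EuclideanSpace ℝ (Fin l)}
    (hq : q = (1 - θ) • p + (χ * c) • (A z - b)) :
    augLag f h A b c θ z q - augLag f h A b c θ z p =
      (1 - θ) / (χ * c) *
        (θ / 2 * (‖q‖ ^ 2 - ‖p‖ ^ 2) + (2 - θ) / 2 * ‖q - p‖ ^ 2) := by
  have e : ⟪q - p, A z - b⟫ * (χ * c) = ⟪q - p, q - (1 - θ) • p⟫ := by
    have : q - (1 - θ) • p = (χ * c) • (A z - b) := by
      conv_lhs => rw [hq]
      abel
    rw [this, inner_smul_right]; ring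
  have e2 : ⟪q - p, q - (1 - θ) • p⟫ =
      θ / 2 * (‖q‖ ^ 2 - ‖p‖ ^ 2) + (2 - θ) / 2 * ‖q - p‖ ^ 2 := by
    rw [norm_sub_sq_real, inner_sub_left, inner_sub_right, inner_sub_right, inner_smul_right,
      inner_smul_right, real_inner_self_eq_norm_sq, real_inner_self_eq_norm_sq,
      real_inner_comm q p]
    ring
  rw [← e2, ← e]
  unfold augLag
  rw [inner_sub_left]
  field_simp
  ring

lemma augLag_ge {n l : ℕ} (f h : EuclideanSpace ℝ (Fin n) → ℝ)
    (A : EuclideanSpace ℝ (Fin n) →L[ℝ] EuclideanSpace ℝ (Fin l))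
    (b : EuclideanSpace ℝ (Fin l)) {c : ℝ} (θ : ℝ) (hc : 0 < c)
    (z : EuclideanSpace ℝ (Fin n)) (p : EuclideanSpace ℝ (Fin l)) :
    f z + h z - (1 - θ) ^ 2 / (2 * c) * ‖p‖ ^ 2 ≤ augLag f h A b c θ z p := by
  have key := norm_add_sq_real ((1 - θ) • p) (c • (A z - b))
  rw [inner_smul_left, inner_smul_right, norm_smul, norm_smul, mul_pow, mul_pow,
    Real.norm_eq_abs, Real.norm_eq_abs, sq_abs, sq_abs, RCLike.conj_to_real] at key
  have h0 : 0 ≤ ‖(1 - θ) • p + c • (A z - b)‖ ^ 2 / (2 * c) := by positivity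
  rw [key] at h0
  unfold augLag
  have : ((1 - θ) ^ 2 * ‖p‖ ^ 2 + 2 * ((1 - θ) * (c * ⟪p, A z - b⟫)) +
      c ^ 2 * ‖A z - b‖ ^ 2) / (2 * c) =
      (1 - θ) ^ 2 / (2 * c) * ‖p‖ ^ 2 + (1 - θ) * ⟪p, A z - b⟫ + c / 2 * ‖A z - b‖ ^ 2 := by
    field_simp
  linarith

/-- Under the setting of the telescoping estimate (Statement 12) together with
the compactness of `H = dom h`, the bounds `‖pᵢ‖ ≤ B_p`, and `φ_* = inf_{ℝⁿ}(f+h) > −∞`,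
`φ* = inf_F (f+h)` over the nonempty feasible set `F = {z ∈ H : Az = b}`, there is an index
`i ∈ {j+1, …, k}` with `λ‖v̂ᵢ‖² ≤ 32 B_Ψ / (k − j)`, where `v̂ᵢ = (vᵢ + zᵢ₋₁ − zᵢ)/λ` and
`B_Ψ = φ* − φ_* + D_h²/λ + ((2 − θ + 2(2−θ)(1−θ))/(2χ²c₁))B_p²`. -/
theorem stmt_17 {n l : ℕ} (h : EuclideanSpace ℝ (Fin n) → ℝ)
    (H : Set (EuclideanSpace ℝ (Fin n))) (hHne : H.Nonempty) (hHcpt : IsCompact H)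
    (hhconv : ConvexOn ℝ H h)
    (hhlsc : LowerSemicontinuous fun x => if x ∈ H then ((h x : ℝ) : EReal) else (⊤ : EReal))
    (Dh : ℝ) (hDh : Dh = Metric.diam H)
    (f : EuclideanSpace ℝ (Fin n) → ℝ) (f' : EuclideanSpace ℝ (Fin n) → EuclideanSpace ℝ (Fin n))
    (hf : ∀ x, HasGradientAt f (f' x) x)
    (m : ℝ) (hm : 0 < m)
    (hwc : ∀ u z, -(m / 2) * ‖u - z‖ ^ 2 ≤ f u - f z - ⟪f' z, u - z⟫)
    (A : EuclideanSpace ℝ (Fin n) →L[ℝ] EuclideanSpace ℝ (Fin l))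
    (b : EuclideanSpace ℝ (Fin l))
    (φlow : ℝ) (hφlow : IsGLB ((fun u => f u + h u) '' H) φlow)
    (hfeas : {u ∈ H | A u = b}.Nonempty)
    (φup : ℝ) (hφup : IsGLB ((fun u => f u + h u) '' {u ∈ H | A u = b}) φup)
    (lam σ c c₁ χ θ : ℝ) (hlam : lam = 1 / (2 * m)) (hσ : σ ∈ Set.Ioc (0 : ℝ) (1 / 2))
    (hc₁ : 0 < c₁) (hc : c₁ ≤ c)
    (hχ : χ ∈ Set.Ioo (0 : ℝ) 1) (hθ : θ ∈ Set.Ioo (0 : ℝ) 1)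
    (hcond : 2 * (1 - θ) * (2 - θ) * χ ≤ θ ^ 2)
    (j k : ℤ) (hjk : j < k)
    (z : ℤ → EuclideanSpace ℝ (Fin n)) (p : ℤ → EuclideanSpace ℝ (Fin l))
    (v : ℤ → EuclideanSpace ℝ (Fin n))
    (hzH : ∀ i, j ≤ i → i ≤ k → z i ∈ H)
    (Bp : ℝ) (hpB : ∀ i, j - 1 ≤ i → i ≤ k → ‖p i‖ ≤ Bp)
    (hp : ∀ i, j ≤ i → i ≤ k → p i = (1 - θ) • p (i - 1) + (χ * c) • (A (z i) - b))
    (hsub : ∀ i, j + 1 ≤ i → i ≤ k → ∀ z' ∈ H,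
      lam * augLag f h A b c θ z' (p (i - 1)) + 1 / 2 * ‖z' - z (i - 1)‖ ^ 2 ≥
        lam * augLag f h A b c θ (z i) (p (i - 1)) + 1 / 2 * ‖z i - z (i - 1)‖ ^ 2 +
          ⟪v i, z' - z i⟫)
    (hv : ∀ i, j + 1 ≤ i → i ≤ k → ‖v i‖ ≤ σ * ‖z i - z (i - 1)‖) :
    ∃ i, j + 1 ≤ i ∧ i ≤ k ∧
      lam * ‖(lam⁻¹ : ℝ) • (v i + z (i - 1) - z i)‖ ^ 2 ≤
        32 * (φup - φlow + Dh ^ 2 / lam +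
          (2 - θ + 2 * (2 - θ) * (1 - θ)) / (2 * χ ^ 2 * c₁) * Bp ^ 2) / ((k : ℝ) - (j : ℝ)) := by
  have hl : 0 < lam := by rw [hlam]; positivity
  have hcpos : 0 < c := hc₁.trans_le hc
  obtain ⟨hχ0, hχ1⟩ := hχ
  have hθ' := hθ
  obtain ⟨hθ0, hθ1⟩ := hθ'
  have hα : 0 < 1 - θ := sub_pos.2 hθ1
  have hdist : ∀ x ∈ H, ∀ y ∈ H, ‖x - y‖ ≤ Dh := fun x hx y hy => by
    rw [hDh, ← dist_eq_norm]
    exact Metric.dist_le_diam_of_mem hHcpt.isBounded hx hy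
  have hDh0 : 0 ≤ Dh := hDh ▸ Metric.diam_nonneg
  have hBp0 : 0 ≤ Bp := (norm_nonneg _).trans (hpB j (by omega) hjk.le)
  have hvhat : ∀ i, j + 1 ≤ i → i ≤ k →
      lam * ‖(lam⁻¹ : ℝ) • (v i + z (i - 1) - z i)‖ ^ 2 ≤
        9 / 4 * (‖z i - z (i - 1)‖ ^ 2 / lam) := by
    intro i hi hik
    have h1 : ‖v i + z (i - 1) - z i‖ ≤ 3 / 2 * ‖z i - z (i - 1)‖ := by
      have : v i + z (i - 1) - z i = v i - (z i - z (i - 1)) := by abel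
      rw [this]
      have h2 := norm_sub_le (v i) (z i - z (i - 1))
      have h3 := mul_le_mul_of_nonneg_right hσ.2 (norm_nonneg (z i - z (i - 1)))
      linarith [hv i hi hik]
    have h2 : ‖v i + z (i - 1) - z i‖ ^ 2 ≤ (3 / 2 * ‖z i - z (i - 1)‖) ^ 2 :=
      pow_le_pow_left₀ (norm_nonneg _) h1 2
    rw [norm_smul, mul_pow, Real.norm_eq_abs, sq_abs]
    have e : lam * (lam⁻¹ ^ 2 * ‖v i + z (i - 1) - z i‖ ^ 2) =
        ‖v i + z (i - 1) - z i‖ ^ 2 / lam := by field_simp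
    rw [e, ← mul_div_assoc]
    gcongr
    linarith
  have hinner : ∀ i, j + 1 ≤ i → i ≤ k → ∀ d, -(⟪v i, d⟫) ≤ 1 / 2 * ‖z i - z (i - 1)‖ * ‖d‖ := by
    intro i hi hik d
    have h1 := neg_le_of_abs_le (abs_real_inner_le_norm (v i) d)
    have h2 : ‖v i‖ ≤ 1 / 2 * ‖z i - z (i - 1)‖ :=
      (hv i hi hik).trans (mul_le_mul_of_nonneg_right hσ.2 (norm_nonneg _))
    linarith [mul_le_mul_of_nonneg_right h2 (norm_nonneg d)]
  set L := augLag f h A b c θ with hL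
  set κ : ℝ := (1 - θ) ^ 2 * (2 - θ) / (2 * χ * c * θ) with hκ
  set μ : ℝ := (1 - θ) * θ / (2 * χ * c) with hμ
  set Φ : ℤ → ℝ := fun i =>
    L (z i) (p i) - μ * ‖p i‖ ^ 2 + κ * ‖p i - p (i - 1)‖ ^ 2 with hΦ
  have hupd : ∀ i, j + 1 ≤ i → i ≤ k → L (z i) (p i) - L (z i) (p (i - 1)) =
      μ * (‖p i‖ ^ 2 - ‖p (i - 1)‖ ^ 2) +
        (1 - θ) * (2 - θ) / (2 * χ * c) * ‖p i - p (i - 1)‖ ^ 2 := by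
    intro i hi hik
    rw [hL, augLag_multiplier_update f h A b θ hcpos hχ0 (hp i (by omega) hik), hμ]
    field_simp
  have hdesc : ∀ i, j + 2 ≤ i → i ≤ k →
      lam * ‖(lam⁻¹ : ℝ) • (v i + z (i - 1) - z i)‖ ^ 2 ≤ 9 * (Φ (i - 1) - Φ i) := by
    intro i hi hik
    have hg := augLag_prox_growth hhconv hm hwc A b c θ hlam (hzH i (by omega) hik)
      (hsub i (by omega) hik) (hzH (i - 1) (by omega) (by omega))
    rw [← hL, sub_self, norm_zero, norm_sub_rev (z (i - 1)) (z i), map_sub,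
      norm_sub_rev (A (z (i - 1)))] at hg
    have hin := hinner i (by omega) hik (z (i - 1) - z i)
    rw [norm_sub_rev (z (i - 1)) (z i)] at hin
    have hdec : 1 / 4 * (‖z i - z (i - 1)‖ ^ 2 / lam) + c / 2 * ‖A (z i) - A (z (i - 1))‖ ^ 2 ≤
        L (z (i - 1)) (p (i - 1)) - L (z i) (p (i - 1)) := by
      refine le_of_mul_le_mul_left ?_ hl
      have e : lam * (1 / 4 * (‖z i - z (i - 1)‖ ^ 2 / lam) +
          c / 2 * ‖A (z i) - A (z (i - 1))‖ ^ 2) =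
          1 / 4 * ‖z i - z (i - 1)‖ ^ 2 + lam * c / 2 * ‖A (z i) - A (z (i - 1))‖ ^ 2 := by
        field_simp
      rw [e]
      nlinarith
    have hrec : p i - p (i - 1) =
        (1 - θ) • (p (i - 1) - p (i - 1 - 1)) + (χ * c) • (A (z i) - A (z (i - 1))) := by
      have h1 := hp i (by omega) hik
      have h2 := hp (i - 1) (by omega) (by omega)
      calc p i - p (i - 1) = ((1 - θ) • p (i - 1) + (χ * c) • (A (z i) - b)) -
            ((1 - θ) • p (i - 1 - 1) + (χ * c) • (A (z (i - 1)) - b)) := by rw [← h1, ← h2]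
        _ = _ := by module
    have hdp := dampened_norm_sq_le hθ hχ0 hcpos hcond (p (i - 1) - p (i - 1 - 1))
      (A (z i) - A (z (i - 1)))
    rw [← hrec, ← hκ] at hdp
    have hu := hupd i (by omega) hik
    have hvh := hvhat i (by omega) hik
    simp only [hΦ]
    linarith
  have hstart : L (z (j + 1)) (p j) ≤ φup + 5 / 8 * (Dh ^ 2 / lam) := by
    rw [← sub_le_iff_le_add]
    refine hφup.2 ?_
    rintro _ ⟨y, ⟨hyH, hyb⟩, rfl⟩
    have hs := hsub (j + 1) le_rfl (by omega) y hyH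
    have hin := hinner (j + 1) le_rfl (by omega) (y - z (j + 1))
    rw [add_sub_cancel_right] at hs hin
    have hLy : augLag f h A b c θ y (p j) = f y + h y := by simp [augLag, hyb]
    rw [← hL] at hLy
    rw [hLy] at hs
    have h1 := hdist y hyH (z j) (hzH j le_rfl hjk.le)
    have h2 := hdist y hyH (z (j + 1)) (hzH (j + 1) (by omega) (by omega))
    have h3 : ‖y - z j‖ ^ 2 ≤ Dh ^ 2 := pow_le_pow_left₀ (norm_nonneg _) h1 2
    have h4 := mul_le_mul_of_nonneg_left h2 (norm_nonneg (z (j + 1) - z j))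
    rw [sub_le_iff_le_add]
    refine le_of_mul_le_mul_left ?_ hl
    have e : lam * (f y + h y + 5 / 8 * (Dh ^ 2 / lam)) =
        lam * (f y + h y) + 5 / 8 * Dh ^ 2 := by field_simp
    rw [e]
    nlinarith [sq_nonneg (‖z (j + 1) - z j‖ - Dh / 2)]
  have hφ : φlow ≤ φup := by
    refine hφup.2 ?_
    rintro _ ⟨y, hy, rfl⟩
    exact hφlow.1 ⟨y, hy.1, rfl⟩
  have hpsq : ∀ i, j - 1 ≤ i → i ≤ k → ‖p i‖ ^ 2 ≤ Bp ^ 2 := fun i hi hik =>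
    pow_le_pow_left₀ (norm_nonneg _) (hpB i hi hik) 2
  have hμ0 : 0 ≤ μ := by rw [hμ]; positivity
  have hκ0 : 0 ≤ κ := by
    have : 0 < 2 - θ := by linarith
    rw [hκ]; positivity
  have htele : Φ (j + 1) - Φ k ≤ φup - φlow + 5 / 8 * (Dh ^ 2 / lam) +
      (1 + θ) / 2 * (Bp ^ 2 / (χ ^ 2 * c)) := by
    have hu := hupd (j + 1) le_rfl (by omega)
    have hlow := augLag_ge f h A b θ hcpos (z k) (p k)
    have hlow' : φlow ≤ f (z k) + h (z k) := hφlow.1 ⟨z k, hzH k hjk.le le_rfl, rfl⟩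
    have hdp : ‖p (j + 1) - p j‖ ^ 2 ≤ 4 * Bp ^ 2 := by
      have h1 := norm_sub_le (p (j + 1)) (p j)
      have h2 := hpB (j + 1) (by omega) (by omega)
      have h3 := hpB j (by omega) hjk.le
      calc ‖p (j + 1) - p j‖ ^ 2 ≤ (2 * Bp) ^ 2 :=
            pow_le_pow_left₀ (norm_nonneg _) (by linarith) 2
        _ = _ := by ring
    have hco : (1 - θ) * (2 - θ) / (2 * χ * c) + κ = (1 - θ) * (2 - θ) / (2 * χ * c * θ) := by
      rw [hκ]; field_simp; ring
    have hco' : (1 - θ) * (2 - θ) / (2 * χ * c * θ) ≤ θ / (4 * (χ ^ 2 * c)) := by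
      rw [div_le_div_iff₀ (by positivity) (by positivity)]
      have := mul_le_mul_of_nonneg_left hcond (show 0 ≤ 2 * χ * c by positivity)
      linarith
    have hd1 := mul_le_mul hco' hdp (by positivity) (by positivity)
    have hk1 := mul_le_mul_of_nonneg_left (hpsq k (by omega) le_rfl) hμ0
    have hk2 := mul_le_mul_of_nonneg_left (hpsq k (by omega) le_rfl)
      (show 0 ≤ (1 - θ) ^ 2 / (2 * c) by positivity)
    have hk3 : 0 ≤ μ * ‖p j‖ ^ 2 := by positivity
    have hk4 : 0 ≤ κ * ‖p k - p (k - 1)‖ ^ 2 := by positivity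
    have hfin := multiplier_coeff_le hθ hχ0 hχ1.le hcpos Bp
    rw [← hμ] at hfin
    have hd2 : θ / (4 * (χ ^ 2 * c)) * (4 * Bp ^ 2) = θ * (Bp ^ 2 / (χ ^ 2 * c)) := by
      field_simp
    rw [← hco] at hd1
    rw [hd2] at hd1
    simp only [hΦ]
    rw [add_sub_cancel_right] at hu ⊢
    linarith
  by_contra! hcon
  set B : ℝ := φup - φlow + Dh ^ 2 / lam +
    (2 - θ + 2 * (2 - θ) * (1 - θ)) / (2 * χ ^ 2 * c₁) * Bp ^ 2 with hB
  have hsum : ∀ i, j + 1 ≤ i → i ≤ k →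
      ((i : ℝ) - j - 1) * (32 * B / ((k : ℝ) - j)) ≤ 9 * (Φ (j + 1) - Φ i) := by
    intro i hi
    induction i, hi using Int.leInduction with
    | base => intro _; simp
    | succ i hi ih =>
      intro hik
      have h1 := ih (by omega)
      have h2 := hcon (i + 1) (by omega) hik
      have h3 := hdesc (i + 1) (by omega) hik
      rw [add_sub_cancel_right] at h2 h3
      push_cast
      linarith
  have hkj : (0 : ℝ) < (k : ℝ) - j := by
    have : (j : ℝ) < k := by exact_mod_cast hjk
    linarith
  have h1 := hsum k (by omega) le_rfl
  have h2 := hcon (j + 1) le_rfl (by omega)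
  have h3 := hvhat (j + 1) le_rfl (by omega)
  rw [add_sub_cancel_right] at h2 h3
  have h4 : ‖z (j + 1) - z j‖ ^ 2 / lam ≤ Dh ^ 2 / lam := by
    have := hdist _ (hzH (j + 1) (by omega) (by omega)) _ (hzH j le_rfl hjk.le)
    gcongr
  have h5 : ((k : ℝ) - j) * (32 * B / ((k : ℝ) - j)) = 32 * B := mul_div_cancel₀ _ hkj.ne'
  have h6 := multiplier_bound_coeff_le hθ hχ0 hc₁ hc Bp
  have h8 : 0 ≤ Dh ^ 2 / lam := by positivity
  linarith
end
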